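/- Pointwise bound for discrete harmonic functions by local L² norms (inequality (3.2) of the paper): Let Ω ⊂ ℝ³ be a convex polyhedron, c > 0, and r ≥ 1 an integer. There exist constants C > 0, k ≥ 1 and h₀ > 0 (depending only on Ω, c and r) such that for every h ∈ (0, h₀], every tetrahedral partition 𝔗 of Ω with mesh size h and quasi-uniformity constant c, every discrete harmonic function u_h ∈ S_h, and every point x₀ ∈ closure(Ω), one has |u_h(x₀)| ≤ C ρ^{−3/2} (∫_{Ω ∩ B(x₀, ρ)} |u_h|² dx)^{1/2}, where ρ = dist(x₀, ∂Ω) + 2kh and B(x₀, ρ) is the open ball of radius ρ centered at x₀. -/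

import Mathlib

open MeasureTheory Metric Set
open scoped RealInnerProductSpace ENNReal NNReal

noncomputable section

/-- Three-dimensional Euclidean space. -/
abbrev E3 : Type := EuclideanSpace ℝ (Fin 3)

/-- A convex polyhedron: a bounded convex open set which is the interior of the
convex hull of a finite set of points. -/
def IsConvexPolyhedron (Ω : Set E3) : Prop :=
  IsOpen Ω ∧ Bornology.IsBounded Ω ∧ Convex ℝ Ω ∧
    ∃ S : Finset E3, Ω = interior (convexHull ℝ (S : Set E3))

/-- The closed tetrahedron with vertices `v 0, v 1, v 2, v 3`. -/
def tet (v : Fin 4 → E3) : Set E3 := convexHull ℝ (Set.range v)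

/-- A quasi-uniform conforming tetrahedral partition of `Ω` with mesh size `h`
and quasi-uniformity constant `c`, recorded by the vertex tuples of its tetrahedra. -/
def IsTetPartition (Ω : Set E3) (T : Finset (Fin 4 → E3)) (h c : ℝ) : Prop :=
  (∀ v ∈ T, AffineIndependent ℝ v) ∧
  (⋃ v ∈ T, tet v) = closure Ω ∧
  (∀ v ∈ T, ∀ w ∈ T, tet v ≠ tet w → interior (tet v) ∩ interior (tet w) = ∅) ∧
  (∀ v ∈ T, ∀ w ∈ T, tet v ≠ tet w →
    tet v ∩ tet w = ∅ ∨ tet v ∩ tet w = convexHull ℝ (Set.range v ∩ Set.range w)) ∧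
  (∀ v ∈ T, Metric.diam (tet v) ≤ h) ∧
  (∀ v ∈ T, ∃ x : E3, Metric.closedBall x (c * h) ⊆ tet v)

/-- The finite element space `S_h` of continuous piecewise polynomials of degree `≤ r`. -/
def MemSh (Ω : Set E3) (T : Finset (Fin 4 → E3)) (r : ℕ) (u : E3 → ℝ) : Prop :=
  ContinuousOn u (closure Ω) ∧
  ∀ v ∈ T, ∃ p : MvPolynomial (Fin 3) ℝ,
    p.totalDegree ≤ r ∧ ∀ x ∈ tet v, u x = MvPolynomial.eval (fun i => x i) p

/-- The subspace `S̊_h` of finite element functions vanishing on the boundary. -/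
def MemSh0 (Ω : Set E3) (T : Finset (Fin 4 → E3)) (r : ℕ) (u : E3 → ℝ) : Prop :=
  MemSh Ω T r u ∧ ∀ x ∈ frontier Ω, u x = 0

/-- The Laplacian, as the trace of the Hessian. -/
def lap (v : E3 → ℝ) (x : E3) : ℝ :=
  ∑ i : Fin 3,
    fderiv ℝ (fun y => fderiv ℝ v y (EuclideanSpace.single i 1)) x (EuclideanSpace.single i 1)

/-- The `L^p(A)` norm. -/
def LpN (A : Set E3) (p : ℝ) (w : E3 → ℝ) : ℝ := (∫ x in A, |w x| ^ p) ^ (1 / p)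

/-- The `W^{1,p}(A)` norm. -/
def W1pN (A : Set E3) (p : ℝ) (w : E3 → ℝ) : ℝ :=
  (∫ x in A, (|w x| ^ p + ‖gradient w x‖ ^ p)) ^ (1 / p)

/-- The `W^{2,p}(A)` norm. -/
def W2pN (A : Set E3) (p : ℝ) (w : E3 → ℝ) : ℝ :=
  (∫ x in A, (|w x| ^ p + ‖gradient w x‖ ^ p + ‖iteratedFDeriv ℝ 2 w x‖ ^ p)) ^ (1 / p)

namespace PB

def pev (p : MvPolynomial (Fin 3) ℝ) (x : E3) : ℝ := MvPolynomial.eval (fun i => x i) p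

def pgrad (p : MvPolynomial (Fin 3) ℝ) (x : E3) : E3 :=
  WithLp.toLp 2 (fun i => pev (MvPolynomial.pderiv i p) x)

lemma hasGradientAt_pev (p : MvPolynomial (Fin 3) ℝ) (x : E3) :
    HasGradientAt (pev p) (pgrad p x) x := by
  induction p using MvPolynomial.induction_on with
  | C a =>
    have h1 : pev (MvPolynomial.C a) = fun _ => a := by ext y; simp [pev]
    have h2 : pgrad (MvPolynomial.C a) x = 0 := by ext i; simp [pgrad, pev]
    rw [h1, h2]; exact hasGradientAt_const _ _
  | add p q hp hq =>
    have h1 : pev (p + q) = fun y => pev p y + pev q y := by ext y; simp [pev]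
    have h2 : pgrad (p + q) x = pgrad p x + pgrad q x := by ext i; simp [pgrad, pev]
    rw [h1, h2]
    rw [hasGradientAt_iff_hasFDerivAt] at *
    rw [map_add]; exact hp.add hq
  | mul_X p i hp =>
    have h1 : pev (p * MvPolynomial.X i) = fun y => pev p y * y i := by ext y; simp [pev]
    rw [h1]
    rw [hasGradientAt_iff_hasFDerivAt] at *
    have h3 : HasFDerivAt (fun y : E3 => y i) (EuclideanSpace.proj i : E3 →L[ℝ] ℝ) x :=
      (EuclideanSpace.proj i : E3 →L[ℝ] ℝ).hasFDerivAt
    have h4 := hp.mul h3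
    have h5 : (InnerProductSpace.toDual ℝ E3) (pgrad (p * MvPolynomial.X i) x) =
        pev p x • (EuclideanSpace.proj i : E3 →L[ℝ] ℝ) +
          x i • (InnerProductSpace.toDual ℝ E3) (pgrad p x) := by
      ext y
      simp [InnerProductSpace.toDual_apply_apply, PiLp.inner_apply, pgrad, pev,
        MvPolynomial.pderiv_X, Pi.single_apply, Fin.sum_univ_three]
      fin_cases i <;> simp <;> ring
    rw [h5]; exact h4

lemma contDiff_pev (p : MvPolynomial (Fin 3) ℝ) {n} : ContDiff ℝ n (pev p) := by
  induction p using MvPolynomial.induction_on with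
  | C a =>
    have h1 : pev (MvPolynomial.C a) = fun _ => a := by ext y; simp [pev]
    rw [h1]; exact contDiff_const
  | add p q hp hq =>
    have h1 : pev (p + q) = fun y => pev p y + pev q y := by ext y; simp [pev]
    rw [h1]; exact hp.add hq
  | mul_X p i hp =>
    have h1 : pev (p * MvPolynomial.X i) = fun y => pev p y * y i := by ext y; simp [pev]
    rw [h1]; exact hp.mul (EuclideanSpace.proj i : E3 →L[ℝ] ℝ).contDiff

lemma continuous_pev (p : MvPolynomial (Fin 3) ℝ) : Continuous (pev p) :=
  (contDiff_pev p (n := 0)).continuous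

lemma continuous_pgrad (p : MvPolynomial (Fin 3) ℝ) : Continuous (pgrad p) := by
  unfold pgrad
  exact (PiLp.continuous_toLp 2 _).comp (continuous_pi fun i => continuous_pev _)

lemma totalDegree_bind_le (f : Fin 3 → MvPolynomial (Fin 3) ℝ) (hf : ∀ i, (f i).totalDegree ≤ 1)
    (p : MvPolynomial (Fin 3) ℝ) : (MvPolynomial.bind₁ f p).totalDegree ≤ p.totalDegree := by
  conv_lhs => rw [p.as_sum]
  rw [map_sum]
  apply MvPolynomial.totalDegree_finsetSum_le
  intro m hm
  rw [MvPolynomial.bind₁_monomial]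
  refine (MvPolynomial.totalDegree_mul _ _).trans ?_
  rw [MvPolynomial.totalDegree_C, zero_add]
  refine (MvPolynomial.totalDegree_finsetProd _ _).trans ?_
  refine le_trans ?_ (MvPolynomial.le_totalDegree hm)
  unfold Finsupp.sum
  apply Finset.sum_le_sum
  intro i _
  refine (MvPolynomial.totalDegree_pow _ _).trans ?_
  nlinarith [hf i, Nat.zero_le (m i)]

lemma totalDegree_pderiv_le (i : Fin 3) (p : MvPolynomial (Fin 3) ℝ) :
    (MvPolynomial.pderiv i p).totalDegree ≤ p.totalDegree := by
  conv_lhs => rw [p.as_sum]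
  rw [map_sum]
  apply MvPolynomial.totalDegree_finsetSum_le
  intro m hm
  rw [MvPolynomial.pderiv_monomial]
  refine le_trans (MvPolynomial.totalDegree_monomial_le _ _) ?_
  refine le_trans ?_ (MvPolynomial.le_totalDegree hm)
  have : m - Finsupp.single i 1 ≤ m := tsub_le_self
  exact Finsupp.degree_mono this

def monos (r : ℕ) : Finset (Fin 3 →₀ ℕ) :=
  (Finsupp.finite_of_degree_le (σ := Fin 3) r).toFinset

lemma as_sum_monos {r : ℕ} {p : MvPolynomial (Fin 3) ℝ} (hp : p.totalDegree ≤ r) :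
    p = ∑ m : monos r, MvPolynomial.monomial m.1 (p.coeff m.1) := by
  rw [Finset.sum_coe_sort (monos r) (fun m => MvPolynomial.monomial m (p.coeff m))]
  conv_lhs => rw [p.as_sum]
  apply Finset.sum_subset
  · intro m hm
    simp only [monos, Set.Finite.mem_toFinset, Set.mem_ofPred_eq]
    exact (MvPolynomial.le_totalDegree hm).trans hp
  · intro m _ hm
    simp [MvPolynomial.notMem_support_iff.1 hm]

def pofc (r : ℕ) (a : monos r → ℝ) : MvPolynomial (Fin 3) ℝ :=
  ∑ m : monos r, MvPolynomial.monomial m.1 (a m)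

lemma coeff_pofc (r : ℕ) (a : monos r → ℝ) (m : monos r) : (pofc r a).coeff m.1 = a m := by
  classical
  simp [pofc, MvPolynomial.coeff_sum, MvPolynomial.coeff_monomial, Subtype.ext_iff.symm]

lemma pev_pofc (r : ℕ) (a : monos r → ℝ) (x : E3) :
    pev (pofc r a) x = ∑ m : monos r, a m * pev (MvPolynomial.monomial m.1 1) x := by
  simp [pofc, pev, MvPolynomial.eval_monomial]

lemma pev_pderiv_pofc (r : ℕ) (a : monos r → ℝ) (i : Fin 3) (x : E3) :
    pev (MvPolynomial.pderiv i (pofc r a)) x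
      = ∑ m : monos r, a m * pev (MvPolynomial.pderiv i (MvPolynomial.monomial m.1 1)) x := by
  simp [pofc, pev, MvPolynomial.eval_monomial, MvPolynomial.pderiv_monomial]
  apply Finset.sum_congr rfl
  intros; ring

lemma pev_eq_zero_of_ball {p : MvPolynomial (Fin 3) ℝ}
    (h : ∀ x ∈ ball (0 : E3) 1, pev p x = 0) : p = 0 := by
  apply MvPolynomial.funext_set (fun _ => Set.Ioo (-(1/2) : ℝ) (1/2))
  · intro i; exact Set.Ioo_infinite (by norm_num)
  · intro x hx
    have := h (WithLp.toLp 2 x) ?_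
    · simpa [pev] using this
    · rw [mem_ball_zero_iff, EuclideanSpace.norm_eq]
      rw [Real.sqrt_lt' one_pos]
      have hx' : ∀ i, x i ^ 2 < 1/4 := by
        intro i
        have := hx i (Set.mem_univ i)
        nlinarith [this.1, this.2]
      simp only [Real.norm_eq_abs, sq_abs, Fin.sum_univ_three]
      nlinarith [hx' 0, hx' 1, hx' 2]

/-- norm equivalence -/
lemma coef_bound (r : ℕ) : ∃ C : ℝ, 0 < C ∧ ∀ a : monos r → ℝ,
    ‖a‖ ^ 2 ≤ C * ∫ x in closedBall (0 : E3) 1, (pev (pofc r a) x) ^ 2 := by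
  set Q : (monos r → ℝ) → ℝ := fun a => ∫ x in closedBall (0 : E3) 1, (pev (pofc r a) x) ^ 2
    with hQ
  have hint : ∀ p : MvPolynomial (Fin 3) ℝ, IntegrableOn (pev p) (closedBall (0 : E3) 1) :=
    fun p => (continuous_pev p).continuousOn.integrableOn_compact (isCompact_closedBall _ _)
  have hQc : Continuous Q := by
    have : Q = fun a => ∑ m : monos r, ∑ n : monos r, (a m * a n) *
        ∫ x in closedBall (0 : E3) 1, pev (MvPolynomial.monomial m.1 1) x *
          pev (MvPolynomial.monomial n.1 1) x := by
      funext a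
      simp only [hQ]
      have e : ∀ x, (pev (pofc r a) x) ^ 2 = ∑ m : monos r, ∑ n : monos r, (a m * a n) *
          (pev (MvPolynomial.monomial m.1 1) x * pev (MvPolynomial.monomial n.1 1) x) := by
        intro x
        rw [pev_pofc, sq, Finset.sum_mul_sum]
        refine Finset.sum_congr rfl fun m _ => Finset.sum_congr rfl fun n _ => by ring
      simp_rw [e]
      have hi : ∀ m n : monos r, IntegrableOn (fun x => (a m * a n) *
          (pev (MvPolynomial.monomial m.1 1) x * pev (MvPolynomial.monomial n.1 1) x))
          (closedBall (0 : E3) 1) := by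
        intro m n
        exact ((continuous_const.mul ((continuous_pev _).mul
          (continuous_pev _)))).continuousOn.integrableOn_compact (isCompact_closedBall _ _)
      rw [integral_finsetSum _ (fun m _ => integrable_finsetSum _ fun n _ => hi m n)]
      refine Finset.sum_congr rfl fun m _ => ?_
      rw [integral_finsetSum _ (fun n _ => hi m n)]
      refine Finset.sum_congr rfl fun n _ => ?_
      rw [integral_const_mul]
    rw [this]; fun_prop
  have hpos : ∀ a, a ≠ 0 → 0 < Q a := by
    intro a ha
    have hnn : 0 ≤ Q a := integral_nonneg fun x => sq_nonneg _
    rcases hnn.lt_or_eq with h | h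
    · exact h
    exfalso; apply ha
    have hc2 : Continuous fun x => (pev (pofc r a) x) ^ 2 := (continuous_pev _).pow 2
    have h0 : pofc r a = 0 := by
      apply pev_eq_zero_of_ball
      have hz : (fun x => (pev (pofc r a) x) ^ 2) =ᵐ[volume.restrict (closedBall (0:E3) 1)] 0 := by
        rw [← integral_eq_zero_iff_of_nonneg (fun x => sq_nonneg _)]
        · exact h.symm
        · exact hc2.continuousOn.integrableOn_compact (isCompact_closedBall _ _)
      have hz2 : (fun x => (pev (pofc r a) x) ^ 2) =ᵐ[volume.restrict (ball (0:E3) 1)] 0 :=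
        ae_restrict_of_ae_restrict_of_subset ball_subset_closedBall hz
      have := Measure.eqOn_open_of_ae_eq hz2 isOpen_ball hc2.continuousOn continuousOn_const
      intro x hx
      have := this hx
      simpa using this
    funext m
    rw [← coeff_pofc r a m, h0]; simp
  have hhom : ∀ (t : ℝ) a, Q (t • a) = t ^ 2 * Q a := by
    intro t a
    simp only [hQ]
    rw [← integral_const_mul]
    congr 1; funext x
    rw [pev_pofc, pev_pofc, ← mul_pow, Finset.mul_sum]
    congr 1
    refine Finset.sum_congr rfl fun m _ => by simp [mul_assoc]
  obtain hne | hem := (sphere (0 : monos r → ℝ) 1).eq_empty_or_nonempty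
  · refine ⟨1, one_pos, fun a => ?_⟩
    by_cases ha : a = 0
    · subst ha; simp only [norm_zero]
      have : 0 ≤ ∫ x in closedBall (0 : E3) 1, (pev (pofc r 0) x) ^ 2 :=
        integral_nonneg fun x => sq_nonneg _
      simpa using this
    · exfalso
      have : (‖a‖⁻¹ • a) ∈ sphere (0 : monos r → ℝ) 1 := by
        simp [norm_smul, inv_mul_cancel₀ (norm_ne_zero_iff.2 ha)]
      rw [hne] at this; exact this
  · obtain ⟨b, hb, hmin⟩ := (isCompact_sphere (0 : monos r → ℝ) 1).exists_isMinOn hem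
      hQc.continuousOn
    have hb0 : b ≠ 0 := by rintro rfl; simp at hb
    refine ⟨(Q b)⁻¹, inv_pos.2 (hpos b hb0), fun a => ?_⟩
    by_cases ha : a = 0
    · subst ha
      have : 0 ≤ Q 0 := integral_nonneg fun x => sq_nonneg _
      have h2 := mul_nonneg (inv_pos.2 (hpos b hb0)).le this
      simpa using h2
    · have hm : (‖a‖⁻¹ • a) ∈ sphere (0 : monos r → ℝ) 1 := by
        simp [norm_smul, inv_mul_cancel₀ (norm_ne_zero_iff.2 ha)]
      have h1 : Q b ≤ Q (‖a‖⁻¹ • a) := hmin hm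
      rw [hhom] at h1
      have hn : 0 < ‖a‖ := norm_pos_iff.2 ha
      rw [inv_mul_eq_div, le_div_iff₀ (hpos b hb0)]
      change ‖a‖ ^ 2 * Q b ≤ Q a
      calc ‖a‖ ^ 2 * Q b ≤ ‖a‖ ^ 2 * (‖a‖⁻¹ ^ 2 * Q a) := by gcongr
        _ = Q a := by field_simp

end PB

namespace PB

lemma unit_est (r : ℕ) (ρ : ℝ) : ∃ C : ℝ, 0 < C ∧ ∀ q : MvPolynomial (Fin 3) ℝ,
    q.totalDegree ≤ r → ∀ y ∈ closedBall (0 : E3) ρ,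
    (pev q y) ^ 2 ≤ C * ∫ x in closedBall (0 : E3) 1, (pev q x) ^ 2 ∧
    ‖pgrad q y‖ ^ 2 ≤ C * ∫ x in closedBall (0 : E3) 1, (pev q x) ^ 2 := by
  obtain ⟨C0, hC0, hco⟩ := coef_bound r
  have key : ∀ f : monos r → MvPolynomial (Fin 3) ℝ, ∃ B : ℝ, 0 ≤ B ∧
      ∀ a : monos r → ℝ, ∀ y ∈ closedBall (0 : E3) ρ,
        (∑ m, a m * pev (f m) y) ^ 2 ≤ B * ‖a‖ ^ 2 := by
    intro f
    obtain ⟨B, hB⟩ := (isCompact_closedBall (0 : E3) ρ).exists_bound_of_continuousOn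
      (f := fun y => ∑ m : monos r, |pev (f m) y|)
      (continuous_finsetSum _ fun m _ => (continuous_pev _).abs).continuousOn
    refine ⟨B ^ 2, sq_nonneg _, fun a y hy => ?_⟩
    have h1 : |∑ m, a m * pev (f m) y| ≤ B * ‖a‖ := by
      calc |∑ m, a m * pev (f m) y| ≤ ∑ m, |a m * pev (f m) y| := Finset.abs_sum_le_sum_abs _ _
        _ ≤ ∑ m, ‖a‖ * |pev (f m) y| := by
            apply Finset.sum_le_sum; intro m _
            rw [abs_mul]
            gcongr
            exact norm_le_pi_norm a m
        _ = (∑ m, |pev (f m) y|) * ‖a‖ := by rw [← Finset.mul_sum, mul_comm]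
        _ ≤ B * ‖a‖ := by
            gcongr
            exact (le_abs_self _).trans (hB y hy)
    rw [← sq_abs, ← mul_pow]
    gcongr
  obtain ⟨B, hB0, hB⟩ := key (fun m => MvPolynomial.monomial m.1 1)
  choose D hD0 hD using fun i : Fin 3 =>
    key (fun m => MvPolynomial.pderiv i (MvPolynomial.monomial m.1 1))
  have hDs : 0 ≤ ∑ i, D i := Finset.sum_nonneg fun i _ => hD0 i
  refine ⟨(B + ∑ i, D i + 1) * C0, by positivity, fun q hq y hy => ?_⟩
  set a : monos r → ℝ := fun m => q.coeff m.1 with ha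
  have hqa : q = pofc r a := as_sum_monos hq
  have hn := hco a
  rw [← hqa] at hn
  have hI : 0 ≤ ∫ x in closedBall (0 : E3) 1, (pev q x) ^ 2 := integral_nonneg fun x => sq_nonneg _
  set I := ∫ x in closedBall (0 : E3) 1, (pev q x) ^ 2
  have hfin : ∀ t, t ≤ (B + ∑ i, D i + 1) * ‖a‖ ^ 2 → t ≤ (B + ∑ i, D i + 1) * C0 * I := by
    intro t ht
    refine ht.trans ?_
    rw [mul_assoc]
    gcongr
  constructor
  · apply hfin
    rw [hqa, pev_pofc]
    refine (hB a y hy).trans ?_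
    gcongr
    linarith
  · apply hfin
    have : ‖pgrad q y‖ ^ 2 = ∑ i, (pev (MvPolynomial.pderiv i q) y) ^ 2 := by
      rw [EuclideanSpace.norm_sq_eq]
      simp [pgrad]
    rw [this]
    calc ∑ i, (pev (MvPolynomial.pderiv i q) y) ^ 2 ≤ ∑ i, D i * ‖a‖ ^ 2 := by
          apply Finset.sum_le_sum; intro i _
          rw [hqa, pev_pderiv_pofc]
          exact hD i a y hy
      _ = (∑ i, D i) * ‖a‖ ^ 2 := by rw [Finset.sum_mul]
      _ ≤ _ := by gcongr; linarith

def psub (z : E3) (t : ℝ) (p : MvPolynomial (Fin 3) ℝ) : MvPolynomial (Fin 3) ℝ :=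
  MvPolynomial.bind₁ (fun i => MvPolynomial.C (z i) + MvPolynomial.C t * MvPolynomial.X i) p

lemma psub_deg (z : E3) (t : ℝ) (p : MvPolynomial (Fin 3) ℝ) :
    (psub z t p).totalDegree ≤ p.totalDegree := by
  apply totalDegree_bind_le
  intro i
  refine (MvPolynomial.totalDegree_add _ _).trans ?_
  refine max_le (by simp) ?_
  refine (MvPolynomial.totalDegree_mul _ _).trans ?_
  simp

lemma pev_psub (z : E3) (t : ℝ) (p : MvPolynomial (Fin 3) ℝ) (y : E3) :
    pev (psub z t p) y = pev p (z + t • y) := by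
  unfold pev psub
  rw [← MvPolynomial.coe_aeval_eq_eval, ← MvPolynomial.coe_aeval_eq_eval]
  simp only [RingHom.coe_coe]
  rw [MvPolynomial.aeval_bind₁]
  congr 2
  funext i
  simp

lemma pgrad_psub (z : E3) (t : ℝ) (p : MvPolynomial (Fin 3) ℝ) (y : E3) :
    pgrad (psub z t p) y = t • pgrad p (z + t • y) := by
  apply (hasGradientAt_pev (psub z t p) y).unique
  have h1 : pev (psub z t p) = fun y => pev p (z + t • y) := funext fun y => pev_psub z t p y
  rw [h1, hasGradientAt_iff_hasFDerivAt]
  have h2 := (hasGradientAt_iff_hasFDerivAt.1 (hasGradientAt_pev p (z + t • y)))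
  have h3 : HasFDerivAt (fun y : E3 => z + t • y) (t • ContinuousLinearMap.id ℝ E3) y :=
    ((hasFDerivAt_id y).const_smul t).const_add z
  have h4 := h2.comp y h3
  refine h4.congr_fderiv ?_
  ext w
  simp [inner_smul_left, inner_smul_right]

open scoped Pointwise in
lemma int_psub (z : E3) {t : ℝ} (ht : 0 < t) (p : MvPolynomial (Fin 3) ℝ) :
    ∫ y in closedBall (0 : E3) 1, (pev (psub z t p) y) ^ 2
      = (t ^ 3)⁻¹ * ∫ x in closedBall z t, (pev p x) ^ 2 := by
  simp_rw [pev_psub]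
  have h1 := Measure.setIntegral_comp_smul (volume : Measure E3) (fun x => (pev p (z + x)) ^ 2)
    (closedBall (0 : E3) 1) ht.ne'
  rw [h1]
  have h2 : t • closedBall (0 : E3) 1 = closedBall (0 : E3) t := by
    rw [_root_.smul_closedBall _ _ zero_le_one]
    simp [abs_of_pos ht]
  rw [h2]
  have h3 : ∫ x in closedBall (0 : E3) t, (pev p (z + x)) ^ 2 = ∫ x in closedBall z t, (pev p x) ^ 2 := by
    have h4 := (measurePreserving_add_left (volume : Measure E3) z).setIntegral_preimage_emb
      (measurableEmbedding_addLeft z) (fun x => (pev p x) ^ 2) (closedBall z t)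
    rw [← h4]
    congr 2
    ext x; simp [mem_closedBall]
  rw [h3]
  simp [abs_of_pos ht, finrank_euclideanSpace]

/-- inverse estimates on a shape-regular set -/
lemma inv_est (r : ℕ) {c : ℝ} (hc : 0 < c) : ∃ C : ℝ, 0 < C ∧ ∀ h : ℝ, 0 < h →
    ∀ (z : E3) (τ : Set E3), IsCompact τ → closedBall z (c * h) ⊆ τ → τ ⊆ closedBall z h →
    ∀ p : MvPolynomial (Fin 3) ℝ, p.totalDegree ≤ r → ∀ x ∈ τ,
    (pev p x) ^ 2 ≤ C * (h ^ 3)⁻¹ * ∫ y in τ, (pev p y) ^ 2 ∧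
    h ^ 2 * ‖pgrad p x‖ ^ 2 ≤ C * (h ^ 3)⁻¹ * ∫ y in τ, (pev p y) ^ 2 := by
  obtain ⟨C, hC, hu⟩ := unit_est r (1 / c)
  refine ⟨C * (c ^ 3)⁻¹ + C * (c ^ 5)⁻¹, by positivity, ?_⟩
  intro h hh z τ hτ hin hout p hp x hx
  have ht : 0 < c * h := by positivity
  set y : E3 := (c * h)⁻¹ • (x - z) with hy
  have hxy : z + (c * h) • y = x := by
    rw [hy, smul_inv_smul₀ ht.ne']; abel
  have hyb : y ∈ closedBall (0 : E3) (1 / c) := by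
    rw [mem_closedBall_zero_iff, hy, norm_smul, norm_inv, Real.norm_eq_abs, abs_of_pos ht,
      ← dist_eq_norm]
    have := hout hx
    rw [mem_closedBall] at this
    rw [inv_mul_le_iff₀ ht]
    calc dist x z ≤ h := this
      _ = c * h * (1 / c) := by field_simp
  obtain ⟨h1, h2⟩ := hu (psub z (c * h) p) ((psub_deg _ _ _).trans hp) y hyb
  rw [int_psub z ht] at h1 h2
  rw [pev_psub, hxy] at h1
  rw [pgrad_psub, hxy, norm_smul, mul_pow, Real.norm_eq_abs, sq_abs] at h2
  have hi : IntegrableOn (fun y => (pev p y) ^ 2) τ :=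
    ((continuous_pev p).pow 2).continuousOn.integrableOn_compact hτ
  have hmono : ∫ x in closedBall z (c * h), (pev p x) ^ 2 ≤ ∫ y in τ, (pev p y) ^ 2 :=
    setIntegral_mono_set hi (Filter.Eventually.of_forall fun x => sq_nonneg _)
      (LE.le.eventuallyLE hin)
  have hI0 : 0 ≤ ∫ x in closedBall z (c * h), (pev p x) ^ 2 := integral_nonneg fun x => sq_nonneg _
  set I := ∫ x in closedBall z (c * h), (pev p x) ^ 2
  set J := ∫ y in τ, (pev p y) ^ 2
  have hJ : 0 ≤ J := hI0.trans hmono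
  constructor
  · calc (pev p x) ^ 2 ≤ C * (((c * h) ^ 3)⁻¹ * I) := h1
      _ ≤ C * (((c * h) ^ 3)⁻¹ * J) := by gcongr
      _ = C * (c ^ 3)⁻¹ * (h ^ 3)⁻¹ * J := by rw [mul_pow, mul_inv]; ring
      _ ≤ _ := by
        gcongr
        have : 0 ≤ C * (c ^ 5)⁻¹ := by positivity
        linarith
  · calc h ^ 2 * ‖pgrad p x‖ ^ 2 = (c ^ 2)⁻¹ * ((c * h) ^ 2 * ‖pgrad p x‖ ^ 2) := by
          field_simp
      _ ≤ (c ^ 2)⁻¹ * (C * (((c * h) ^ 3)⁻¹ * J)) := by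
          refine mul_le_mul_of_nonneg_left (h2.trans ?_) (by positivity)
          gcongr
      _ = C * (c ^ 5)⁻¹ * (h ^ 3)⁻¹ * J := by field_simp
      _ ≤ _ := by
        gcongr
        have : 0 ≤ C * (c ^ 3)⁻¹ := by positivity
        linarith

end PB

namespace PB

def bas (v : Fin 4 → E3) (hv : AffineIndependent ℝ v) : AffineBasis (Fin 4) ℝ E3 :=
  ⟨v, hv, by rw [hv.affineSpan_eq_top_iff_card_eq_finrank_add_one]; simp⟩

open scoped Classical in
def vs (v : Fin 4 → E3) : Finset E3 := Finset.univ.image v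

lemma coe_vs (v : Fin 4 → E3) : (vs v : Set E3) = Set.range v := by
  classical
  simp [vs]

lemma sum_vs {v : Fin 4 → E3} (hv : AffineIndependent ℝ v) {M : Type*} [AddCommMonoid M]
    (F : E3 → M) : ∑ p ∈ vs v, F p = ∑ i, F (v i) := by
  classical
  unfold vs
  rw [Finset.sum_image (fun i _ j _ h => hv.injective h)]

lemma mem_vs (v : Fin 4 → E3) (i : Fin 4) : v i ∈ vs v := by
  classical
  simp [vs]

open scoped Classical in
def bc (v : Fin 4 → E3) (hv : AffineIndependent ℝ v) (x : E3) (p : E3) : ℝ :=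
  ∑ i, if v i = p then (bas v hv).coord i x else 0

lemma bc_apply (v : Fin 4 → E3) (hv : AffineIndependent ℝ v) (x : E3) (i : Fin 4) :
    bc v hv x (v i) = (bas v hv).coord i x := by
  classical
  simp [bc, hv.injective.eq_iff]

lemma bc_of_comb {v : Fin 4 → E3} (hv : AffineIndependent ℝ v) (g : E3 → ℝ)
    (hg : ∑ p ∈ vs v, g p = 1) {x : E3} (hx : ∑ p ∈ vs v, g p • p = x) :
    ∀ p ∈ vs v, bc v hv x p = g p := by
  classical
  intro p hp
  obtain ⟨i, -, rfl⟩ := Finset.mem_image.1 hp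
  rw [bc_apply]
  rw [sum_vs hv] at hg hx
  have h1 := (bas v hv).coord_apply_combination_of_mem (Finset.mem_univ i) (w := fun i => g (v i)) hg
  rw [Finset.univ.affineCombination_eq_linear_combination _ _ hg] at h1
  have h2 : ∑ i, g (v i) • (bas v hv) i = x := hx
  rw [h2] at h1
  exact h1

lemma bc_sum {v : Fin 4 → E3} (hv : AffineIndependent ℝ v) (x : E3) :
    ∑ p ∈ vs v, bc v hv x p = 1 := by
  rw [sum_vs hv]; simp_rw [bc_apply]; exact (bas v hv).sum_coord_apply_eq_one x

lemma bc_comb {v : Fin 4 → E3} (hv : AffineIndependent ℝ v) (x : E3) :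
    ∑ p ∈ vs v, bc v hv x p • p = x := by
  rw [sum_vs hv]; simp_rw [bc_apply]; exact (bas v hv).linear_combination_coord_eq_self x

lemma bc_nonneg {v : Fin 4 → E3} (hv : AffineIndependent ℝ v) {x : E3} (hx : x ∈ tet v) :
    ∀ p ∈ vs v, 0 ≤ bc v hv x p := by
  unfold tet at hx
  rw [← coe_vs, Finset.mem_convexHull'] at hx
  obtain ⟨g, h0, h1, h2⟩ := hx
  intro p hp
  rw [bc_of_comb hv g h1 h2 p hp]; exact h0 p hp

lemma bc_le_one {v : Fin 4 → E3} (hv : AffineIndependent ℝ v) {x : E3} (hx : x ∈ tet v) :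
    ∀ p ∈ vs v, bc v hv x p ≤ 1 := by
  intro p hp
  rw [← bc_sum hv x]
  exact Finset.single_le_sum (f := fun p => bc v hv x p) (bc_nonneg hv hx) hp

def bin (n : ℕ) (t : ℝ) : ℝ := ∏ j ∈ Finset.range n, (t - j) * ((j : ℝ) + 1)⁻¹

lemma bin_zero (t : ℝ) : bin 0 t = 1 := by simp [bin]

lemma bin_nat_lt {n m : ℕ} (h : m < n) : bin n (m : ℝ) = 0 := by
  unfold bin
  apply Finset.prod_eq_zero (Finset.mem_range.2 h)
  simp

lemma bin_self (n : ℕ) : bin n (n : ℝ) = 1 := by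
  unfold bin
  rw [Finset.prod_mul_distrib, Finset.prod_inv_distrib, ← Finset.prod_range_reflect]
  rw [← div_eq_mul_inv, div_eq_one_iff_eq]
  · apply Finset.prod_congr rfl
    intro j hj
    rw [Finset.mem_range] at hj
    have h : n - 1 - j + (j + 1) = n := by omega
    have h2 : ((n - 1 - j : ℕ) : ℝ) + ((j : ℝ) + 1) = n := by exact_mod_cast h
    linarith
  · apply Finset.prod_ne_zero_iff.2; intro j _; positivity

lemma abs_bin_le {n r : ℕ} (hn : n ≤ r) {t : ℝ} (h0 : 0 ≤ t) (h1 : t ≤ r) :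
    |bin n t| ≤ (r : ℝ) ^ n := by
  unfold bin
  rw [Finset.abs_prod]
  calc ∏ j ∈ Finset.range n, |(t - j) * ((j : ℝ) + 1)⁻¹| ≤ ∏ j ∈ Finset.range n, (r : ℝ) := by
        apply Finset.prod_le_prod
        · intro j _; exact abs_nonneg _
        · intro j hj
          rw [Finset.mem_range] at hj
          have hjr : (j : ℝ) ≤ r := by exact_mod_cast (hj.le.trans hn)
          rw [abs_mul, abs_of_nonneg (a := ((j : ℝ) + 1)⁻¹) (by positivity)]
          have ha : |t - j| ≤ r := by
            rw [abs_le]; constructor <;> linarith [Nat.cast_nonneg (α := ℝ) j]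
          have hb : ((j : ℝ) + 1)⁻¹ ≤ 1 := by
            apply inv_le_one_of_one_le₀; linarith [Nat.cast_nonneg (α := ℝ) j]
          calc |t - j| * ((j : ℝ) + 1)⁻¹ ≤ r * 1 := by gcongr
            _ = r := mul_one _
    _ = _ := by simp

def node (r : ℕ) (s : Finset E3) (f : E3 → ℕ) : E3 := ∑ p ∈ s, ((f p : ℝ) / r) • p

open scoped Classical in
def lat (r : ℕ) (s : Finset E3) : Finset (E3 → ℕ) := s.piAntidiag r

lemma mem_lat {r : ℕ} {s : Finset E3} {f : E3 → ℕ} :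
    f ∈ lat r s ↔ s.sum f = r ∧ ∀ p, f p ≠ 0 → p ∈ s := by
  classical
  simp [lat]

def lag (r : ℕ) (s : Finset E3) (w : E3 → ℝ) (μ : E3 → ℝ) : ℝ :=
  ∑ f ∈ lat r s, w (node r s f) * ∏ p ∈ s, bin (f p) (r * μ p)

lemma lag_congr {r : ℕ} {s : Finset E3} {w : E3 → ℝ} {μ ν : E3 → ℝ} (h : ∀ p ∈ s, μ p = ν p) :
    lag r s w μ = lag r s w ν := by
  unfold lag
  refine Finset.sum_congr rfl fun f _ => ?_
  congr 1
  exact Finset.prod_congr rfl fun p hp => by rw [h p hp]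

lemma lag_restrict {r : ℕ} {s t : Finset E3} (hts : t ⊆ s) (w : E3 → ℝ) {μ : E3 → ℝ}
    (h : ∀ p ∈ s, p ∉ t → μ p = 0) : lag r s w μ = lag r t w μ := by
  classical
  unfold lag
  symm
  have hsub : lat r t ⊆ lat r s := by
    intro f hf
    rw [mem_lat] at *
    refine ⟨?_, fun p hp => hts (hf.2 p hp)⟩
    rw [← hf.1]
    symm
    apply Finset.sum_subset hts
    intro p _ hp
    by_contra h0; exact hp (hf.2 p h0)
  have h1 : ∀ f ∈ lat r t, w (node r t f) * ∏ p ∈ t, bin (f p) (r * μ p)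
      = w (node r s f) * ∏ p ∈ s, bin (f p) (r * μ p) := by
    intro f hf
    rw [mem_lat] at hf
    have hz : ∀ p ∉ t, f p = 0 := fun p hp => by by_contra h0; exact hp (hf.2 p h0)
    have e1 : node r t f = node r s f := by
      unfold node
      apply Finset.sum_subset hts
      intro p _ hp; simp [hz p hp]
    have e2 : ∏ p ∈ t, bin (f p) (r * μ p) = ∏ p ∈ s, bin (f p) (r * μ p) := by
      apply Finset.prod_subset hts
      intro p _ hp; simp [hz p hp, bin_zero]
    rw [e1, e2]
  rw [Finset.sum_congr rfl h1]
  apply Finset.sum_subset hsub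
  intro f hf hft
  rw [mem_lat] at hf hft
  have : ∃ p ∈ s, p ∉ t ∧ f p ≠ 0 := by
    by_contra hcon
    push Not at hcon
    apply hft
    have hsupp : ∀ p, f p ≠ 0 → p ∈ t := by
      intro p hp
      by_contra hpt
      exact hp (hcon p (hf.2 p hp) hpt)
    refine ⟨?_, hsupp⟩
    rw [← hf.1]
    apply Finset.sum_subset hts
    intro p _ hp; by_contra h0; exact hp (hsupp p h0)
  obtain ⟨p, hps, hpt, hfp⟩ := this
  have : ∏ p ∈ s, bin (f p) (r * μ p) = 0 := by
    apply Finset.prod_eq_zero hps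
    rw [h p hps hpt, mul_zero]
    have := bin_nat_lt (n := f p) (m := 0) (Nat.pos_of_ne_zero hfp)
    simpa using this
  rw [this, mul_zero]

/-- conformity -/
lemma lag_glue (r : ℕ) {v v' : Fin 4 → E3} (hv : AffineIndependent ℝ v)
    (hv' : AffineIndependent ℝ v') (w : E3 → ℝ) {x : E3}
    (hx : x ∈ convexHull ℝ (Set.range v ∩ Set.range v')) :
    lag r (vs v) w (bc v hv x) = lag r (vs v') w (bc v' hv' x) := by
  classical
  rw [← coe_vs, ← coe_vs, ← Finset.coe_inter, Finset.mem_convexHull'] at hx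
  obtain ⟨g, h0, h1, h2⟩ := hx
  set t := vs v ∩ vs v' with ht
  set g' : E3 → ℝ := fun p => if p ∈ t then g p else 0 with hg'
  have key : ∀ (u : Fin 4 → E3) (hu : AffineIndependent ℝ u), t ⊆ vs u →
      lag r (vs u) w (bc u hu x) = lag r t w g' := by
    intro u hu htu
    have e1 : ∑ p ∈ vs u, g' p = 1 := by
      rw [← h1, ← Finset.sum_subset htu (f := g')]
      · exact Finset.sum_congr rfl fun p hp => by simp [hg', hp]
      · intro p _ hp; simp [hg', hp]
    have e2 : ∑ p ∈ vs u, g' p • p = x := by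
      rw [← h2, ← Finset.sum_subset htu (f := fun p => g' p • p)]
      · exact Finset.sum_congr rfl fun p hp => by simp [hg', hp]
      · intro p _ hp; simp [hg', hp]
    rw [lag_congr (bc_of_comb hu g' e1 e2)]
    apply lag_restrict htu
    intro p _ hp; simp [hg', hp]
  rw [key v hv Finset.inter_subset_left, key v' hv' Finset.inter_subset_right]

lemma affine_poly (A : E3 →ᵃ[ℝ] ℝ) : ∃ q : MvPolynomial (Fin 3) ℝ, q.totalDegree ≤ 1 ∧
    ∀ x, pev q x = A x := by
  refine ⟨MvPolynomial.C (A 0) + ∑ i, MvPolynomial.C (A.linear (EuclideanSpace.single i 1)) *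
    MvPolynomial.X i, ?_, ?_⟩
  · refine (MvPolynomial.totalDegree_add _ _).trans (max_le (by simp) ?_)
    apply MvPolynomial.totalDegree_finsetSum_le
    intro i _
    exact (MvPolynomial.totalDegree_mul _ _).trans (by simp)
  · intro x
    have h1 : A x = A.linear x + A 0 := by
      have := congrFun (A.decomp) x
      simpa using this
    have h2 : x = ∑ i, x i • EuclideanSpace.single i (1 : ℝ) := by
      ext j; fin_cases j <;> simp [Fin.sum_univ_three]
    rw [h1]
    conv_rhs => rw [h2]
    simp only [pev, map_add, map_sum, MvPolynomial.eval_C, map_mul, MvPolynomial.eval_X, map_smul,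
      smul_eq_mul]
    rw [add_comm]
    congr 1
    exact Finset.sum_congr rfl fun i _ => mul_comm _ _

lemma bc_poly {v : Fin 4 → E3} (hv : AffineIndependent ℝ v) (p : E3) :
    ∃ q : MvPolynomial (Fin 3) ℝ, q.totalDegree ≤ 1 ∧ ∀ x, pev q x = bc v hv x p := by
  classical
  choose q hq1 hq2 using fun i => affine_poly ((bas v hv).coord i)
  refine ⟨∑ i, if v i = p then q i else 0, ?_, ?_⟩
  · apply MvPolynomial.totalDegree_finsetSum_le
    intro i _
    split_ifs
    · exact hq1 i
    · simp
  · intro x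
    unfold bc
    simp only [pev, map_sum]
    refine Finset.sum_congr rfl fun i _ => ?_
    split_ifs
    · exact hq2 i x
    · simp

lemma lag_poly (r : ℕ) {v : Fin 4 → E3} (hv : AffineIndependent ℝ v) (w : E3 → ℝ) :
    ∃ q : MvPolynomial (Fin 3) ℝ, q.totalDegree ≤ r ∧
      ∀ x, pev q x = lag r (vs v) w (bc v hv x) := by
  choose b hb1 hb2 using bc_poly hv
  refine ⟨∑ f ∈ lat r (vs v), MvPolynomial.C (w (node r (vs v) f)) *
    ∏ p ∈ vs v, ∏ j ∈ Finset.range (f p),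
      (MvPolynomial.C (r : ℝ) * b p - MvPolynomial.C (j : ℝ)) * MvPolynomial.C (((j : ℝ) + 1)⁻¹),
    ?_, ?_⟩
  · apply MvPolynomial.totalDegree_finsetSum_le
    intro f hf
    refine (MvPolynomial.totalDegree_mul _ _).trans ?_
    rw [MvPolynomial.totalDegree_C, zero_add]
    refine (MvPolynomial.totalDegree_finsetProd _ _).trans ?_
    rw [← (mem_lat.1 hf).1]
    apply Finset.sum_le_sum
    intro p _
    refine (MvPolynomial.totalDegree_finsetProd _ _).trans ?_
    refine (Finset.sum_le_card_nsmul _ _ 1 ?_).trans (by simp)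
    intro j _
    refine (MvPolynomial.totalDegree_mul _ _).trans ?_
    rw [MvPolynomial.totalDegree_C, add_zero]
    refine (MvPolynomial.totalDegree_sub _ _).trans (max_le ?_ (by rw [MvPolynomial.totalDegree_C]; exact Nat.zero_le _))
    refine (MvPolynomial.totalDegree_mul _ _).trans ?_
    rw [MvPolynomial.totalDegree_C, zero_add]
    exact hb1 p
  · intro x
    unfold lag bin
    simp only [← hb2, pev, map_sum, map_mul, map_prod, map_sub, MvPolynomial.eval_C]

lemma node_bc {r : ℕ} (hr : 1 ≤ r) {v : Fin 4 → E3} (hv : AffineIndependent ℝ v) {f : E3 → ℕ}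
    (hf : f ∈ lat r (vs v)) : ∀ p ∈ vs v, bc v hv (node r (vs v) f) p = (f p : ℝ) / r := by
  apply bc_of_comb hv (fun p => (f p : ℝ) / r)
  · rw [← Finset.sum_div, ← Nat.cast_sum, (mem_lat.1 hf).1]
    apply div_self; positivity
  · rfl

lemma node_mem {r : ℕ} (hr : 1 ≤ r) {v : Fin 4 → E3} {f : E3 → ℕ}
    (hf : f ∈ lat r (vs v)) : node r (vs v) f ∈ tet v := by
  unfold tet
  rw [← coe_vs, Finset.mem_convexHull']
  refine ⟨fun p => (f p : ℝ) / r, fun p _ => by positivity, ?_, rfl⟩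
  rw [← Finset.sum_div, ← Nat.cast_sum, (mem_lat.1 hf).1]
  apply div_self; positivity

lemma lag_node {r : ℕ} (hr : 1 ≤ r) {v : Fin 4 → E3} (hv : AffineIndependent ℝ v) (w : E3 → ℝ)
    {f : E3 → ℕ} (hf : f ∈ lat r (vs v)) :
    lag r (vs v) w (bc v hv (node r (vs v) f)) = w (node r (vs v) f) := by
  have hr0 : (r : ℝ) ≠ 0 := by positivity
  rw [lag_congr (node_bc hr hv hf)]
  unfold lag
  have e : ∀ p : E3, (r : ℝ) * ((f p : ℝ) / r) = f p := fun p => by field_simp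
  simp_rw [e]
  rw [Finset.sum_eq_single_of_mem f hf]
  · rw [Finset.prod_eq_one, mul_one]
    intro p _; exact bin_self _
  · intro g hg hgf
    have : ∃ p ∈ vs v, f p < g p := by
      by_contra hcon
      push Not at hcon
      apply hgf
      have h1 := (Finset.sum_eq_sum_iff_of_le hcon).1
        ((mem_lat.1 hg).1.trans (mem_lat.1 hf).1.symm)
      funext p
      by_cases hp : p ∈ vs v
      · exact h1 p hp
      · have a1 : f p = 0 := by by_contra h0; exact hp ((mem_lat.1 hf).2 p h0)
        have a2 : g p = 0 := by by_contra h0; exact hp ((mem_lat.1 hg).2 p h0)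
        rw [a1, a2]
    obtain ⟨p, hp, hlt⟩ := this
    rw [Finset.prod_eq_zero hp (bin_nat_lt hlt), mul_zero]

lemma card_lat {r : ℕ} (v : Fin 4 → E3) : (lat r (vs v)).card ≤ (r + 1) ^ 4 := by
  classical
  have h : (lat r (vs v)).card ≤ (Fintype.piFinset fun _ : Fin 4 => Finset.range (r + 1)).card := by
    apply Finset.card_le_card_of_injOn (fun f i => f (v i))
    · intro f hf
      have hf' := mem_lat.1 hf
      rw [Finset.mem_coe, Fintype.mem_piFinset]
      intro i
      rw [Finset.mem_range]
      show f (v i) < r + 1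
      have := Finset.single_le_sum (f := f) (fun p _ => Nat.zero_le _) (mem_vs v i)
      exact Nat.lt_succ_of_le (this.trans hf'.1.le)
    · intro f hf g hg hfg
      have hf' := mem_lat.1 hf
      have hg' := mem_lat.1 hg
      funext p
      by_cases hp : p ∈ vs v
      · obtain ⟨i, -, rfl⟩ := Finset.mem_image.1 hp
        exact congrFun hfg i
      · have a1 : f p = 0 := by by_contra h0; exact hp (hf'.2 p h0)
        have a2 : g p = 0 := by by_contra h0; exact hp (hg'.2 p h0)
        rw [a1, a2]
  refine h.trans ?_
  simp

lemma lag_bound {r : ℕ} (hr : 1 ≤ r) {v : Fin 4 → E3} (hv : AffineIndependent ℝ v) (w : E3 → ℝ)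
    {M : ℝ} (hM : ∀ y ∈ tet v, |w y| ≤ M) {x : E3} (hx : x ∈ tet v) :
    |lag r (vs v) w (bc v hv x)| ≤ ((r : ℝ) + 1) ^ 4 * (r : ℝ) ^ r * M := by
  have hM0 : 0 ≤ M := (abs_nonneg _).trans (hM x hx)
  unfold lag
  calc |∑ f ∈ lat r (vs v), w (node r (vs v) f) * ∏ p ∈ vs v, bin (f p) (r * bc v hv x p)|
      ≤ ∑ f ∈ lat r (vs v), |w (node r (vs v) f) * ∏ p ∈ vs v, bin (f p) (r * bc v hv x p)| :=
        Finset.abs_sum_le_sum_abs _ _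
    _ ≤ ∑ f ∈ lat r (vs v), M * (r : ℝ) ^ r := by
        apply Finset.sum_le_sum
        intro f hf
        rw [abs_mul]
        gcongr
        · exact hM _ (node_mem hr hf)
        · rw [Finset.abs_prod]
          conv_rhs => rw [← (mem_lat.1 hf).1]
          rw [← Finset.prod_pow_eq_pow_sum]
          rw [(mem_lat.1 hf).1]
          apply Finset.prod_le_prod
          · intro p _; exact abs_nonneg _
          · intro p hp
            apply abs_bin_le
            · rw [← (mem_lat.1 hf).1]
              exact Finset.single_le_sum (f := f) (fun p _ => Nat.zero_le _) hp
            · exact mul_nonneg (by positivity) (bc_nonneg hv hx p hp)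
            · exact mul_le_of_le_one_right (by positivity) (bc_le_one hv hx p hp)
    _ = (lat r (vs v)).card * (M * (r : ℝ) ^ r) := by simp
    _ ≤ ((r : ℝ) + 1) ^ 4 * (M * (r : ℝ) ^ r) := by
        gcongr
        exact_mod_cast card_lat v
    _ = _ := by ring

lemma unisolv {r : ℕ} (hr : 1 ≤ r) {v : Fin 4 → E3} (hv : AffineIndependent ℝ v)
    {q : MvPolynomial (Fin 3) ℝ} (hq : q.totalDegree ≤ r)
    (h0 : ∀ f ∈ lat r (vs v), pev q (node r (vs v) f) = 0) (x : E3) : pev q x = 0 := by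
  classical
  have hr0 : (r : ℝ) ≠ 0 := by positivity
  set pt : E3 → E3 := fun y => v 0 + ∑ j : Fin 3, (y j / r) • (v j.succ - v 0) with hpt
  set D := MvPolynomial.bind₁ (fun i : Fin 3 => MvPolynomial.C (v 0 i) +
    ∑ j : Fin 3, MvPolynomial.C ((v j.succ i - v 0 i) / r) * MvPolynomial.X j) q with hD
  have hDdeg : D.totalDegree ≤ r := by
    refine (totalDegree_bind_le _ ?_ q).trans hq
    intro i
    refine (MvPolynomial.totalDegree_add _ _).trans (max_le (by simp) ?_)
    apply MvPolynomial.totalDegree_finsetSum_le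
    intro j _
    exact (MvPolynomial.totalDegree_mul _ _).trans (by simp)
  have hDev : ∀ y : E3, pev D y = pev q (pt y) := by
    intro y
    unfold pev
    rw [hD, ← MvPolynomial.coe_aeval_eq_eval, ← MvPolynomial.coe_aeval_eq_eval]
    simp only [RingHom.coe_coe]
    rw [MvPolynomial.aeval_bind₁]
    congr 2
    funext i
    simp [hpt, Fin.sum_univ_three]
    ring
  have hD0 : D = 0 := by
    by_contra hne
    have hsup : D.support.Nonempty := by
      rwa [MvPolynomial.support_nonempty]
    obtain ⟨t, ht, hteq⟩ := Finset.exists_mem_eq_sup D.support hsup (fun s => s.sum fun _ e => e)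
    obtain ⟨s, hs, hse⟩ := MvPolynomial.combinatorial_nullstellensatz_exists_eval_nonzero D t
      (MvPolynomial.mem_support_iff.1 ht) hteq
      (fun i => (Finset.range (t i + 1)).image (fun n : ℕ => (n : ℝ)))
      (fun i => by rw [Finset.card_image_of_injective _ Nat.cast_injective]; simp)
    have hs' : ∀ i, ∃ n : ℕ, n ≤ t i ∧ (n : ℝ) = s i := by
      intro i
      obtain ⟨n, hn, hns⟩ := Finset.mem_image.1 (hs i)
      exact ⟨n, by simpa [Nat.lt_succ_iff] using hn, hns⟩
    choose n hn hns using hs'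
    have htd : t.sum (fun _ e => e) ≤ r := by
      have : D.totalDegree = t.sum (fun _ e => e) := hteq
      omega
    have hsum : n 0 + n 1 + n 2 ≤ r := by
      have : t.sum (fun _ e => e) = t 0 + t 1 + t 2 := by
        rw [Finsupp.sum_fintype _ _ (fun _ => rfl), Fin.sum_univ_three]
      have := hn 0; have := hn 1; have := hn 2
      omega
    set α : Fin 4 → ℕ := ![r - (n 0 + n 1 + n 2), n 0, n 1, n 2] with hα
    set f : E3 → ℕ := fun p => ∑ i, if v i = p then α i else 0 with hf
    have hfv : ∀ i, f (v i) = α i := by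
      intro i; simp [hf, hv.injective.eq_iff]
    have hfl : f ∈ lat r (vs v) := by
      rw [mem_lat]
      constructor
      · have e1 : ∑ i, f (v i) = ∑ i, α i := Finset.sum_congr rfl (fun i _ => hfv i)
        have e2 : ∑ i, α i = r - (n 0 + n 1 + n 2) + n 0 + n 1 + n 2 := by
          rw [Fin.sum_univ_four]; rfl
        rw [sum_vs hv f, e1, e2]; omega
      · intro p hp
        by_contra hcon
        apply hp
        simp only [hf]
        apply Finset.sum_eq_zero
        intro i _
        rw [if_neg]
        rintro rfl
        exact hcon (mem_vs v i)
    have hnode : node r (vs v) f = pt (WithLp.toLp 2 s) := by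
      unfold node
      rw [sum_vs hv (fun p => ((f p : ℝ) / r) • p)]
      simp only [hfv, hpt, Fin.sum_univ_four, Fin.sum_univ_three, ← hns]
      have hc : ((r - (n 0 + n 1 + n 2) : ℕ) : ℝ) = r - (n 0 + n 1 + n 2) := by
        rw [Nat.cast_sub hsum]; push_cast; ring
      have e0 : ((α 0 : ℕ) : ℝ) = r - (n 0 + n 1 + n 2) := by rw [← hc]; simp [hα]
      have e1 : α 1 = n 0 := by simp [hα]
      have e2 : α 2 = n 1 := by simp [hα]
      have e3 : α 3 = n 2 := by simp [hα]
      rw [e0, e1, e2, e3]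
      ext i
      simp only [PiLp.add_apply, PiLp.smul_apply, PiLp.sub_apply, smul_eq_mul]
      have s0 : (0 : Fin 3).succ = (1 : Fin 4) := rfl
      have s1 : (1 : Fin 3).succ = (2 : Fin 4) := rfl
      have s2 : (2 : Fin 3).succ = (3 : Fin 4) := rfl
      rw [s0, s1, s2]
      field_simp
      ring
    apply hse
    have := hDev (WithLp.toLp 2 s)
    rw [← hnode, h0 f hfl] at this
    simpa [pev] using this
  have hx : x = pt (WithLp.toLp 2 fun j => r * (bas v hv).coord j.succ x) := by
    have h1 := (bas v hv).linear_combination_coord_eq_self x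
    have h2 := (bas v hv).sum_coord_apply_eq_one x
    rw [Fin.sum_univ_succ] at h1 h2
    have h3 : ∀ i, (bas v hv) i = v i := fun i => rfl
    simp only [h3] at h1
    simp only [hpt]
    conv_lhs => rw [← h1]
    have e : ∀ j : Fin 3, (r : ℝ) * (bas v hv).coord j.succ x / r = (bas v hv).coord j.succ x :=
      fun j => by field_simp
    simp only [e]
    have h4 : (bas v hv).coord 0 x = 1 - ∑ j : Fin 3, (bas v hv).coord j.succ x := by linarith
    rw [h4]
    simp only [smul_sub, Finset.sum_sub_distrib, sub_smul, one_smul, ← Finset.sum_smul]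
    abel
  rw [hx, ← hDev, hD0]
  simp [pev]

/-- reproduction -/
lemma lag_repro {r : ℕ} (hr : 1 ≤ r) {v : Fin 4 → E3} (hv : AffineIndependent ℝ v)
    {q : MvPolynomial (Fin 3) ℝ} (hq : q.totalDegree ≤ r) (x : E3) :
    lag r (vs v) (pev q) (bc v hv x) = pev q x := by
  obtain ⟨Q, hQ1, hQ2⟩ := lag_poly r hv (pev q)
  have := unisolv hr hv (q := Q - q) ((MvPolynomial.totalDegree_sub _ _).trans (max_le hQ1 hq))
    (fun f hf => by
      have h1 : pev (Q - q) (node r (vs v) f) = pev Q (node r (vs v) f) - pev q (node r (vs v) f) := by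
        simp [pev]
      rw [h1, hQ2, lag_node hr hv _ hf, sub_self]) x
  have h1 : pev (Q - q) x = pev Q x - pev q x := by simp [pev]
  rw [h1, hQ2] at this
  linarith

lemma lag_congr_w {r : ℕ} (hr : 1 ≤ r) {v : Fin 4 → E3} {w w' : E3 → ℝ} {μ : E3 → ℝ}
    (h : ∀ y ∈ tet v, w y = w' y) : lag r (vs v) w μ = lag r (vs v) w' μ := by
  unfold lag
  refine Finset.sum_congr rfl fun f hf => ?_
  rw [h _ (node_mem hr hf)]

lemma lag_add (r : ℕ) (s : Finset E3) (w w' : E3 → ℝ) (μ : E3 → ℝ) :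
    lag r s (fun y => w y + w' y) μ = lag r s w μ + lag r s w' μ := by
  unfold lag
  rw [← Finset.sum_add_distrib]
  refine Finset.sum_congr rfl fun f _ => by ring

end PB

namespace PB

lemma isCompact_tet (v : Fin 4 → E3) : IsCompact (tet v) :=
  (Set.finite_range v).isCompact_convexHull ℝ

lemma convex_tet (v : Fin 4 → E3) : Convex ℝ (tet v) := convex_convexHull ℝ _

lemma tet_dist {v : Fin 4 → E3} {h : ℝ} (hd : Metric.diam (tet v) ≤ h) {x y : E3}
    (hx : x ∈ tet v) (hy : y ∈ tet v) : ‖x - y‖ ≤ h := by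
  rw [← dist_eq_norm]
  exact (Metric.dist_le_diam_of_mem (isCompact_tet v).isBounded hx hy).trans hd

lemma tet_sub_ball {v : Fin 4 → E3} {h c : ℝ} (hd : Metric.diam (tet v) ≤ h) {z : E3}
    (hc : 0 ≤ c * h) (hz : closedBall z (c * h) ⊆ tet v) : tet v ⊆ closedBall z h := by
  intro y hy
  rw [mem_closedBall, dist_eq_norm]
  exact tet_dist hd hy (hz (mem_closedBall_self hc))

lemma hasGradientAt_const_inner (a x : E3) : HasGradientAt (fun y : E3 => ⟪a, y⟫) a x := by
  rw [hasGradientAt_iff_hasFDerivAt]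
  exact (InnerProductSpace.toDual ℝ E3 a).hasFDerivAt

lemma mvt_tet {v : Fin 4 → E3} {f : E3 → ℝ} {g : E3 → E3} {M : ℝ}
    (hf : ∀ y ∈ tet v, HasGradientAt f (g y) y) (hg : ∀ y ∈ tet v, ‖g y‖ ≤ M) {x y : E3}
    (hx : x ∈ tet v) (hy : y ∈ tet v) : |f y - f x| ≤ M * ‖y - x‖ := by
  have := (convex_tet v).norm_image_sub_le_of_norm_hasFDerivWithin_le (f := f)
    (f' := fun y => InnerProductSpace.toDual ℝ E3 (g y)) (C := M)
    (fun z hz => (hf z hz).hasFDerivAt.hasFDerivWithinAt)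
    (fun z hz => by rw [LinearIsometryEquiv.norm_map]; exact hg z hz) hx hy
  simpa using this

lemma gradient_unique {f : E3 → ℝ} {a b x : E3} (h1 : HasGradientAt f a x)
    (h2 : HasGradientAt f b x) : a = b := HasGradientAt.unique h1 h2

lemma vol_cb : ∃ B : ℝ, 0 < B ∧ ∀ (z : E3) (h : ℝ), 0 < h → ∀ τ : Set E3, τ ⊆ closedBall z h →
    (volume τ).toReal ≤ B * h ^ 3 := by
  refine ⟨(volume (closedBall (0 : E3) 1)).toReal + 1, by positivity, ?_⟩
  intro z h hh τ hτ
  have h1 : (volume τ).toReal ≤ (volume (closedBall z h)).toReal :=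
    ENNReal.toReal_mono measure_closedBall_lt_top.ne (measure_mono hτ)
  have h2 : (volume (closedBall z h)).toReal = h ^ 3 * (volume (closedBall (0 : E3) 1)).toReal := by
    rw [Measure.addHaar_closedBall' _ _ hh.le, ENNReal.toReal_mul, ENNReal.toReal_ofReal (by positivity)]
    simp
  rw [h2] at h1
  refine h1.trans ?_
  have : 0 < h ^ 3 := by positivity
  nlinarith

lemma grad_interp (r : ℕ) (hr : 1 ≤ r) {c : ℝ} (hc : 0 < c) : ∃ C : ℝ, 0 < C ∧ ∀ h : ℝ, 0 < h →
    ∀ (v : Fin 4 → E3) (hv : AffineIndependent ℝ v) (z : E3), Metric.diam (tet v) ≤ h →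
    closedBall z (c * h) ⊆ tet v → ∀ (w : E3 → ℝ) (M : ℝ), (∀ y ∈ tet v, |w y| ≤ M) →
    ∀ q : MvPolynomial (Fin 3) ℝ, q.totalDegree ≤ r →
    (∀ x, pev q x = lag r (vs v) w (bc v hv x)) → ∀ x ∈ tet v, h * ‖pgrad q x‖ ≤ C * M := by
  obtain ⟨C, hC, hinv⟩ := inv_est r hc
  obtain ⟨B, hB, hvol⟩ := vol_cb
  set L : ℝ := ((r : ℝ) + 1) ^ 4 * (r : ℝ) ^ r with hL
  have hL0 : 0 < L := by positivity
  refine ⟨Real.sqrt (C * B) * L, by positivity, ?_⟩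
  intro h hh v hv z hd hz w M hM q hq hqe x hx
  have hsub := tet_sub_ball hd (by positivity) hz
  have hM0 : 0 ≤ M := (abs_nonneg _).trans (hM x hx)
  have h1 := (hinv h hh z (tet v) (isCompact_tet v) hz hsub q hq x hx).2
  have h2 : ∫ y in tet v, (pev q y) ^ 2 ≤ (L * M) ^ 2 * (B * h ^ 3) := by
    have hb : ∀ y ∈ tet v, ‖(pev q y) ^ 2‖ ≤ (L * M) ^ 2 := by
      intro y hy
      rw [Real.norm_eq_abs, abs_pow, hqe]
      exact pow_le_pow_left₀ (abs_nonneg _) (lag_bound hr hv w hM hy) 2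
    have := norm_setIntegral_le_of_norm_le_const (μ := volume) (isCompact_tet v).measure_lt_top hb
    refine (le_abs_self _).trans (this.trans ?_)
    exact mul_le_mul_of_nonneg_left (hvol z h hh _ hsub) (by positivity)
  have h3 : (h * ‖pgrad q x‖) ^ 2 ≤ (Real.sqrt (C * B) * L * M) ^ 2 := by
    calc (h * ‖pgrad q x‖) ^ 2 = h ^ 2 * ‖pgrad q x‖ ^ 2 := by ring
      _ ≤ C * (h ^ 3)⁻¹ * ((L * M) ^ 2 * (B * h ^ 3)) := h1.trans (by gcongr)
      _ = C * B * (L * M) ^ 2 := by field_simp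
      _ = (Real.sqrt (C * B) * L * M) ^ 2 := by
        rw [mul_assoc (Real.sqrt _), mul_pow (Real.sqrt _), Real.sq_sqrt (by positivity)]
  exact (pow_le_pow_iff_left₀ (by positivity) (by positivity) two_ne_zero).1 h3

lemma local_err (r : ℕ) (hr : 1 ≤ r) {c : ℝ} (hc : 0 < c) : ∃ C : ℝ, 0 < C ∧ ∀ h : ℝ, 0 < h →
    ∀ (v : Fin 4 → E3) (hv : AffineIndependent ℝ v) (z : E3), Metric.diam (tet v) ≤ h →
    closedBall z (c * h) ⊆ tet v →
    ∀ (p : MvPolynomial (Fin 3) ℝ), p.totalDegree ≤ r →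
    ∀ (Φ : E3 → ℝ) (V : E3 → E3) (D1 D2 M0 M1 : ℝ), (∀ y ∈ tet v, HasGradientAt Φ (V y) y) →
    (∀ y ∈ tet v, ‖V y‖ ≤ D1) → (∀ y ∈ tet v, ∀ y' ∈ tet v, ‖V y - V y'‖ ≤ D2 * h) →
    (∀ y ∈ tet v, |pev p y| ≤ M0) → (∀ y ∈ tet v, ‖pgrad p y‖ ≤ M1) →
    ∀ q : MvPolynomial (Fin 3) ℝ, q.totalDegree ≤ r →
    (∀ x, pev q x = lag r (vs v) (fun y => pev p y * Φ y) (bc v hv x)) → ∀ x ∈ tet v,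
    ‖pgrad q x - (Φ x • pgrad p x + pev p x • V x)‖ ≤ C * h * (D2 * M0 + D1 * M1) := by
  obtain ⟨C, hC, H⟩ := grad_interp r hr hc
  refine ⟨C, hC, ?_⟩
  intro h hh v hv z hd hz p hp Φ V D1 D2 M0 M1 hΦ hD1 hD2 hM0 hM1 q hq hqe x hx
  have hM0' : 0 ≤ M0 := (abs_nonneg _).trans (hM0 x hx)
  have hM1' : 0 ≤ M1 := (norm_nonneg _).trans (hM1 x hx)
  have hD1' : 0 ≤ D1 := (norm_nonneg _).trans (hD1 x hx)
  have hD2' : 0 ≤ D2 * h := (norm_nonneg _).trans (hD2 x hx x hx)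
  set w : E3 → ℝ := fun y => pev p x * (Φ y - Φ x - ⟪V x, y - x⟫) + (pev p y - pev p x) * (Φ y - Φ x)
    with hw
  obtain ⟨l, hl1, hl2⟩ := affine_poly
    ((innerₗ E3 (V x)).toAffineMap - AffineMap.const ℝ E3 (⟪V x, x⟫ : ℝ))
  have hl3 : ∀ y, pev l y = ⟪V x, y - x⟫ := by
    intro y; rw [hl2, inner_sub_right]; simp
  set P : MvPolynomial (Fin 3) ℝ := MvPolynomial.C (Φ x) * p + MvPolynomial.C (pev p x) * l with hP
  have hPd : P.totalDegree ≤ r := by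
    refine (MvPolynomial.totalDegree_add _ _).trans (max_le ?_ ?_)
    · refine (MvPolynomial.totalDegree_mul _ _).trans ?_
      rw [MvPolynomial.totalDegree_C]; omega
    · refine (MvPolynomial.totalDegree_mul _ _).trans ?_
      rw [MvPolynomial.totalDegree_C]; omega
  have hPe : ∀ y, pev P y = Φ x * pev p y + pev p x * ⟪V x, y - x⟫ := by
    intro y
    rw [← hl3]
    simp [hP, pev]
  have hPg : pgrad P x = Φ x • pgrad p x + pev p x • V x := by
    apply gradient_unique (hasGradientAt_pev P x)
    have e : pev P = fun y => Φ x * pev p y + pev p x * (⟪V x, y⟫ - ⟪V x, x⟫) := by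
      funext y; rw [hPe, inner_sub_right]
    rw [e, hasGradientAt_iff_hasFDerivAt]
    have a1 := (hasGradientAt_pev p x).hasFDerivAt.const_mul (Φ x)
    have a2 := ((hasGradientAt_const_inner (V x) x).hasFDerivAt.sub_const ⟪V x, x⟫).const_mul (pev p x)
    have := a1.add a2
    have e2 : InnerProductSpace.toDual ℝ E3 (Φ x • pgrad p x + pev p x • V x) =
        Φ x • InnerProductSpace.toDual ℝ E3 (pgrad p x) +
          pev p x • InnerProductSpace.toDual ℝ E3 (V x) := by
      simp [map_add, map_smul]
    rw [e2]
    exact this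
  have hQe : ∀ y, pev (q - P) y = lag r (vs v) w (bc v hv y) := by
    intro y
    have h1 : pev (q - P) y = pev q y - pev P y := by simp [pev]
    have h2 := lag_add r (vs v) (pev P) w (bc v hv y)
    have h3 : (fun y => pev P y + w y) = fun y => pev p y * Φ y := by
      funext y; rw [hPe, hw]; ring
    rw [h3, lag_repro hr hv hPd] at h2
    rw [h1, hqe, h2]; ring
  have hwb : ∀ y ∈ tet v, |w y| ≤ h ^ 2 * (D2 * M0 + D1 * M1) := by
    intro y hy
    have hyx := tet_dist hd hy hx
    have b1 : |Φ y - Φ x - ⟪V x, y - x⟫| ≤ D2 * h * h := by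
      have := mvt_tet (v := v) (f := fun y => Φ y - ⟪V x, y⟫) (g := fun y => V y - V x) (M := D2 * h)
        (fun y hy => by
          rw [hasGradientAt_iff_hasFDerivAt, map_sub]
          exact (hΦ y hy).hasFDerivAt.sub (hasGradientAt_const_inner (V x) y).hasFDerivAt)
        (fun y hy => hD2 y hy x hx) hx hy
      have e : Φ y - Φ x - ⟪V x, y - x⟫ = (Φ y - ⟪V x, y⟫) - (Φ x - ⟪V x, x⟫) := by
        rw [inner_sub_right]; ring
      rw [e]
      exact this.trans (by gcongr)
    have b2 : |pev p y - pev p x| ≤ M1 * h :=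
      (mvt_tet (fun y _ => hasGradientAt_pev p y) hM1 hx hy).trans (by gcongr)
    have b3 : |Φ y - Φ x| ≤ D1 * h := (mvt_tet hΦ hD1 hx hy).trans (by gcongr)
    calc |w y| ≤ |pev p x| * |Φ y - Φ x - ⟪V x, y - x⟫| + |pev p y - pev p x| * |Φ y - Φ x| := by
          rw [hw, ← abs_mul, ← abs_mul]; exact abs_add_le _ _
      _ ≤ M0 * (D2 * h * h) + (M1 * h) * (D1 * h) := by
          gcongr; exact hM0 x hx
      _ = _ := by ring
  have key := H h hh v hv z hd hz w _ hwb (q - P)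
    ((MvPolynomial.totalDegree_sub _ _).trans (max_le hq hPd)) hQe x hx
  have e : pgrad (q - P) x = pgrad q x - pgrad P x := by
    apply gradient_unique (hasGradientAt_pev _ x)
    have e : pev (q - P) = fun y => pev q y - pev P y := by funext y; simp [pev]
    rw [e, hasGradientAt_iff_hasFDerivAt, map_sub]
    exact (hasGradientAt_pev q x).hasFDerivAt.sub (hasGradientAt_pev P x).hasFDerivAt
  rw [e, hPg] at key
  have : h * ‖pgrad q x - (Φ x • pgrad p x + pev p x • V x)‖ ≤ h * (C * h * (D2 * M0 + D1 * M1)) := by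
    refine key.trans (le_of_eq ?_); ring
  exact le_of_mul_le_mul_left this hh

end PB

namespace PB

lemma pw_lip_aux {T : Finset (Fin 4 → E3)} {S : Set E3} (hS : Convex ℝ S)
    (hT : (⋃ v ∈ T, tet v) = S) {u : E3 → ℝ} (hu : ContinuousOn u S) {L : ℝ} (hL0 : 0 ≤ L)
    (hL : ∀ v ∈ T, ∀ x ∈ tet v, ∀ y ∈ tet v, u y - u x ≤ L * ‖y - x‖) {x y : E3}
    (hx : x ∈ S) (hy : y ∈ S) : u y - u x ≤ L * ‖y - x‖ := by
  set γ : ℝ → E3 := fun t => x + t • (y - x) with hγ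
  have hγc : Continuous γ := by rw [hγ]; fun_prop
  have hγS : ∀ t ∈ Icc (0 : ℝ) 1, γ t ∈ S := fun t ht => hS.add_smul_sub_mem hx hy ht
  have key := image_le_of_liminf_slope_right_le_deriv_boundary (f := fun t => u (γ t)) (a := 0) (b := 1)
    (B := fun t => u x + t * (L * ‖y - x‖)) (B' := fun _ => L * ‖y - x‖)
    (hu.comp hγc.continuousOn hγS) (by simp [hγ]) (by fun_prop)
    (fun t _ => by
      have := ((hasDerivAt_id t).mul_const (L * ‖y - x‖)).const_add (u x)
      simpa using this.hasDerivWithinAt) ?_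
  · have := key (right_mem_Icc.2 zero_le_one)
    simp [hγ] at this
    linarith
  · intro t ht ρ hρ
    have hin : ∀ᶠ z in nhdsWithin t (Ioi t), z ∈ Ioc t 1 := by
      exact Ioc_mem_nhdsGT ht.2
    have hex : ∃ v ∈ T, ∃ᶠ z in nhdsWithin t (Ioi t), γ z ∈ tet v := by
      by_contra hcon
      push Not at hcon
      have h1 : ∀ᶠ z in nhdsWithin t (Ioi t), ∀ v ∈ T, γ z ∉ tet v := by
        rw [Filter.eventually_all_finset]
        intro v hv
        exact hcon v hv
      obtain ⟨z, hz1, hz2⟩ := (h1.and hin).exists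
      have hzS := hγS z ⟨ht.1.trans hz2.1.le, hz2.2⟩
      rw [← hT] at hzS
      simp only [mem_iUnion] at hzS
      obtain ⟨v, hv, hzv⟩ := hzS
      exact hz1 v hv hzv
    obtain ⟨v, hv, hfr⟩ := hex
    have htv : γ t ∈ tet v := by
      have hcl : IsClosed (γ ⁻¹' tet v) := (isCompact_tet v).isClosed.preimage hγc
      have : t ∈ closure (γ ⁻¹' tet v) := by
        rw [mem_closure_iff_frequently]
        exact hfr.filter_mono nhdsWithin_le_nhds
      rwa [hcl.closure_eq] at this
    refine (hfr.and_eventually hin).mono ?_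
    rintro z ⟨hz, hz1, hz2⟩
    refine lt_of_le_of_lt ?_ hρ
    have h2 := hL v hv _ htv _ hz
    have e : γ z - γ t = (z - t) • (y - x) := by simp only [hγ, sub_smul]; abel
    rw [e, norm_smul, Real.norm_eq_abs, abs_of_pos (sub_pos.2 hz1)] at h2
    rw [slope_def_field, div_le_iff₀ (sub_pos.2 hz1)]
    linarith

lemma exists_lip {Ω : Set E3} {T : Finset (Fin 4 → E3)} {r : ℕ} {u : E3 → ℝ} (hΩ : Convex ℝ Ω)
    (hT : (⋃ v ∈ T, tet v) = closure Ω) (hu : MemSh Ω T r u) :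
    ∃ (K : ℝ≥0) (U : E3 → ℝ), LipschitzWith K U ∧ EqOn u U (closure Ω) := by
  obtain ⟨hc, hp⟩ := hu
  have h1 : ∀ v ∈ T, ∃ L : ℝ, 0 ≤ L ∧ ∀ x ∈ tet v, ∀ y ∈ tet v, |u y - u x| ≤ L * ‖y - x‖ := by
    intro v hv
    obtain ⟨p, -, hpe⟩ := hp v hv
    obtain ⟨M, hM⟩ := (isCompact_tet v).exists_bound_of_continuousOn (continuous_pgrad p).continuousOn
    refine ⟨max M 0, le_max_right _ _, fun x hx y hy => ?_⟩
    rw [hpe x hx, hpe y hy]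
    exact mvt_tet (fun z _ => hasGradientAt_pev p z) (fun z hz => (hM z hz).trans (le_max_left _ _)) hx hy
  choose! L hL0 hL using h1
  set M := ∑ v ∈ T, L v
  have hM0 : 0 ≤ M := Finset.sum_nonneg hL0
  have hLM : ∀ v ∈ T, L v ≤ M := fun v hv => Finset.single_le_sum (f := L) hL0 hv
  have hlip : LipschitzOnWith ⟨M, hM0⟩ u (closure Ω) := by
    apply LipschitzOnWith.of_dist_le_mul
    intro x hx y hy
    rw [dist_eq_norm, dist_eq_norm, Real.norm_eq_abs]
    have hLa : ∀ v ∈ T, ∀ x ∈ tet v, ∀ y ∈ tet v, u y - u x ≤ M * ‖y - x‖ := by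
      intro v hv x hx y hy
      refine (le_abs_self _).trans ((hL v hv x hx y hy).trans ?_)
      gcongr; exact hLM v hv
    have a1 := pw_lip_aux hΩ.closure hT hc hM0 hLa hx hy
    have a2 := pw_lip_aux hΩ.closure hT hc hM0 hLa hy hx
    rw [norm_sub_rev] at a1
    rw [abs_le]
    constructor
    · show -(M * _) ≤ _
      linarith
    · exact a2
  obtain ⟨U, hU, hUe⟩ := hlip.extend_real
  exact ⟨_, U, hU, hUe⟩

lemma dedupe (T : Finset (Fin 4 → E3)) : ∃ T' ⊆ T, Set.InjOn tet (T' : Set (Fin 4 → E3)) ∧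
    ∀ v ∈ T, ∃ v' ∈ T', tet v' = tet v := by
  classical
  have hs : Set.SurjOn tet (T : Set (Fin 4 → E3)) (T.image tet : Finset (Set E3)) := by
    intro s hs
    simpa using hs
  obtain ⟨T', h1, h2, h3⟩ := Finset.exists_subset_injOn_image_eq_of_surjOn _ _ hs
  refine ⟨T', by exact_mod_cast h1, h2, fun v hv => ?_⟩
  have : tet v ∈ T'.image tet := by rw [h3]; exact Finset.mem_image_of_mem _ hv
  simpa using this

lemma interp_exists {Ω : Set E3} {T : Finset (Fin 4 → E3)} {h c : ℝ} (hT : IsTetPartition Ω T h c)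
    (hinj : Set.InjOn tet (T : Set (Fin 4 → E3))) (r : ℕ) (w : E3 → ℝ) :
    ∃ χ : E3 → ℝ, MemSh Ω T r χ ∧ ∀ v ∈ T, ∀ (hv : AffineIndependent ℝ v), ∀ x ∈ tet v,
      χ x = lag r (vs v) w (bc v hv x) := by
  classical
  obtain ⟨haff, hun, -, hint, -, -⟩ := hT
  have h1 : ∀ x, ∃ t : ℝ, ∀ v ∈ T, ∀ (hv : AffineIndependent ℝ v), x ∈ tet v →
      t = lag r (vs v) w (bc v hv x) := by
    intro x
    by_cases hx : ∃ v ∈ T, x ∈ tet v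
    · obtain ⟨v, hv, hxv⟩ := hx
      refine ⟨lag r (vs v) w (bc v (haff v hv) x), ?_⟩
      intro v' hv' ha hxv'
      by_cases he : tet v = tet v'
      · have : v = v' := hinj hv hv' he
        subst this; rfl
      · rcases hint v hv v' hv' he with h0 | h0
        · have : x ∈ tet v ∩ tet v' := ⟨hxv, hxv'⟩
          rw [h0] at this; exact this.elim
        · apply lag_glue
          rw [← h0]; exact ⟨hxv, hxv'⟩
    · exact ⟨0, fun v hv _ hxv => (hx ⟨v, hv, hxv⟩).elim⟩
  choose χ hχ using h1
  have hval : ∀ v ∈ T, ∀ (hv : AffineIndependent ℝ v), ∀ x ∈ tet v,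
      χ x = lag r (vs v) w (bc v hv x) := fun v hv ha x hx => hχ x v hv ha hx
  have hpoly : ∀ v ∈ T, ∃ p : MvPolynomial (Fin 3) ℝ,
    p.totalDegree ≤ r ∧ ∀ x ∈ tet v, χ x = MvPolynomial.eval (fun i => x i) p := by
    intro v hv
    obtain ⟨q, hq1, hq2⟩ := lag_poly r (haff v hv) w
    refine ⟨q, hq1, fun x hx => ?_⟩
    rw [hval v hv (haff v hv) x hx, ← hq2]; rfl
  refine ⟨χ, ⟨?_, hpoly⟩, hval⟩
  have hun' : closure Ω = ⋃ v : T, tet v.1 := by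
    rw [← hun]; ext x; simp
  rw [hun']
  apply LocallyFinite.continuousOn_iUnion (locallyFinite_of_finite _)
  · intro v; exact (isCompact_tet v.1).isClosed
  · intro v
    obtain ⟨p, -, hpe⟩ := hpoly v.1 v.2
    exact (continuous_pev p).continuousOn.congr hpe

lemma grad_interior {u : E3 → ℝ} {v : Fin 4 → E3} {p : MvPolynomial (Fin 3) ℝ}
    (hp : ∀ x ∈ tet v, u x = pev p x) {x : E3} (hx : x ∈ interior (tet v)) :
    gradient u x = pgrad p x := by
  have : HasGradientAt u (pgrad p x) x := by
    apply (hasGradientAt_pev p x).congr_of_eventuallyEq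
    filter_upwards [isOpen_interior.mem_nhds hx] with y hy
    exact hp y (interior_subset hy)
  exact this.gradient

lemma grad_open {u U : E3 → ℝ} {Ω : Set E3} (hΩ : IsOpen Ω) (h : EqOn u U Ω) {x : E3} (hx : x ∈ Ω) :
    gradient u x = gradient U x := by
  unfold gradient
  congr 1
  apply Filter.EventuallyEq.fderiv_eq
  filter_upwards [hΩ.mem_nhds hx] with y hy
  exact h hy

lemma norm_gradient_le {U : E3 → ℝ} {K : ℝ≥0} (hU : LipschitzWith K U) (x : E3) :
    ‖gradient U x‖ ≤ K := by
  unfold gradient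
  rw [LinearIsometryEquiv.norm_map]
  exact norm_fderiv_le_of_lipschitz ℝ hU

lemma measurable_gradient (U : E3 → ℝ) : Measurable (gradient U) := by
  unfold gradient
  exact (InnerProductSpace.toDual ℝ E3).symm.continuous.measurable.comp (measurable_fderiv ℝ U)

lemma part_ae {Ω : Set E3} {T : Finset (Fin 4 → E3)} (hΩ : Convex ℝ Ω)
    (hT : (⋃ v ∈ T, tet v) = closure Ω) : Ω =ᵐ[volume] (⋃ v ∈ T, interior (tet v) : Set E3) := by
  have h1 : Ω =ᵐ[volume] closure Ω := by
    have := hΩ.addHaar_frontier volume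
    exact (closure_ae_eq_of_null_frontier this).symm
  refine h1.trans ?_
  rw [← hT]
  symm
  apply Filter.EventuallyEq.countable_bUnion T.countable_toSet
  intro v _
  exact interior_ae_eq_of_null_frontier ((convex_tet v).addHaar_frontier volume)

lemma integral_part {Ω : Set E3} {T : Finset (Fin 4 → E3)} {h c : ℝ} (hΩ : Convex ℝ Ω)
    (hT : IsTetPartition Ω T h c)
    (hinj : Set.InjOn tet (T : Set (Fin 4 → E3))) {f : E3 → ℝ} (hf : IntegrableOn f Ω) :
    ∫ x in Ω, f x = ∑ v ∈ T, ∫ x in interior (tet v), f x := by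
  obtain ⟨-, hun, hdis, -, -, -⟩ := hT
  have hae := part_ae hΩ hun
  rw [setIntegral_congr_set hae]
  have hf' : IntegrableOn f (⋃ v ∈ T, interior (tet v)) := hf.congr_set_ae hae.symm
  apply integral_biUnion_finset
  · intro v _; exact isOpen_interior.measurableSet
  · intro v hv w hw hne
    rw [Function.onFun, Set.disjoint_iff_inter_eq_empty]
    exact hdis v hv w hw (fun he => hne (hinj hv hw he))
  · intro v hv
    exact hf'.mono_set (Set.subset_biUnion_of_mem (u := fun v => interior (tet v)) hv)

end PB

namespace PB

def th (R t : ℝ) : ℝ := max 0 (1 - t * (R ^ 2)⁻¹)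
def si (t : ℝ) : ℝ := (Real.sqrt t)⁻¹
def F0 (R t : ℝ) : ℝ := si t * th R t ^ 3
def F1 (R t : ℝ) : ℝ := -(1 / 2) * si t ^ 3 * th R t ^ 3 - 3 * (R ^ 2)⁻¹ * si t * th R t ^ 2
def F2 (R t : ℝ) : ℝ := 3 / 4 * si t ^ 5 * th R t ^ 3 + 3 * (R ^ 2)⁻¹ * si t ^ 3 * th R t ^ 2
  + 6 * (R ^ 2)⁻¹ ^ 2 * si t * th R t

lemma hasDerivAt_maxpow (n : ℕ) (z : ℝ) :
    HasDerivAt (fun z : ℝ => (max 0 z) ^ (n + 2)) ((n + 2) * (max 0 z) ^ (n + 1)) z := by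
  rcases lt_trichotomy z 0 with h | h | h
  · have e : (fun z : ℝ => (max 0 z) ^ (n + 2)) =ᶠ[nhds z] fun _ => 0 := by
      filter_upwards [Iio_mem_nhds h] with y hy
      rw [max_eq_left (le_of_lt hy)]; simp
    rw [max_eq_left h.le]
    simpa using (hasDerivAt_const z (0 : ℝ)).congr_of_eventuallyEq e
  · subst h
    simp only [max_self]
    rw [hasDerivAt_iff_isLittleO]
    simp only [sub_zero, max_self, ne_eq, Nat.add_eq_zero_iff, OfNat.ofNat_ne_zero, and_false,
      not_false_eq_true, zero_pow, smul_eq_mul, one_ne_zero, mul_zero]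
    apply Asymptotics.IsBigO.trans_isLittleO (g := fun z : ℝ => z ^ (n + 2))
    · apply Asymptotics.IsBigO.of_bound 1
      filter_upwards with y
      rw [norm_pow, norm_pow, one_mul]
      apply pow_le_pow_left₀ (norm_nonneg _)
      rw [Real.norm_eq_abs, Real.norm_eq_abs, abs_of_nonneg (le_max_left _ _)]
      exact max_le (abs_nonneg _) (le_abs_self _)
    · simpa using Asymptotics.isLittleO_pow_id (𝕜 := ℝ) (n := n + 2) (by omega)
  · have e : (fun z : ℝ => (max 0 z) ^ (n + 2)) =ᶠ[nhds z] fun z => z ^ (n + 2) := by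
      filter_upwards [Ioi_mem_nhds h] with y hy
      rw [max_eq_right (le_of_lt hy)]
    rw [max_eq_right h.le]
    have := (hasDerivAt_pow (n + 2) z).congr_of_eventuallyEq e
    simpa using this

lemma th_nonneg (R t : ℝ) : 0 ≤ th R t := le_max_left _ _
lemma th_le_one {R t : ℝ} (ht : 0 ≤ t) : th R t ≤ 1 := by
  apply max_le zero_le_one
  have : 0 ≤ t * (R ^ 2)⁻¹ := by positivity
  linarith
lemma si_nonneg (t : ℝ) : 0 ≤ si t := by unfold si; positivity

lemma hasDerivAt_th (R : ℝ) (n : ℕ) (t : ℝ) :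
    HasDerivAt (fun t => th R t ^ (n + 2)) (-(R ^ 2)⁻¹ * ((n + 2) * th R t ^ (n + 1))) t := by
  have h1 : HasDerivAt (fun t : ℝ => 1 - t * (R ^ 2)⁻¹) (-(R ^ 2)⁻¹) t := by
    simpa using ((hasDerivAt_id t).mul_const ((R ^ 2)⁻¹)).const_sub 1
  have h2 := (hasDerivAt_maxpow n (1 - t * (R ^ 2)⁻¹)).comp t h1
  rw [mul_comm]
  exact h2

lemma hasDerivAt_si {t : ℝ} (ht : 0 < t) : HasDerivAt si (-(1 / 2) * si t ^ 3) t := by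
  have hs : Real.sqrt t ≠ 0 := (Real.sqrt_pos.2 ht).ne'
  have := (Real.hasDerivAt_sqrt ht.ne').inv hs
  have e : -(1 / 2) * si t ^ 3 = -(1 / (2 * Real.sqrt t)) / Real.sqrt t ^ 2 := by
    unfold si
    field_simp
  rw [e]
  exact this

lemma hasDerivAt_F0 (R : ℝ) {t : ℝ} (ht : 0 < t) : HasDerivAt (F0 R) (F1 R t) t := by
  have := (hasDerivAt_si ht).mul (hasDerivAt_th R 1 t)
  refine this.congr_deriv ?_
  unfold F1
  norm_num
  ring

lemma hasDerivAt_F1 (R : ℝ) {t : ℝ} (ht : 0 < t) : HasDerivAt (F1 R) (F2 R t) t := by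
  have h1 := (((hasDerivAt_si ht).pow 3).const_mul (-(1 / 2))).mul (hasDerivAt_th R 1 t)
  have h2 := ((hasDerivAt_si ht).const_mul (3 * (R ^ 2)⁻¹)).mul (hasDerivAt_th R 0 t)
  have := h1.sub h2
  refine this.congr_deriv ?_
  unfold F2
  norm_num
  ring

def aa (x0 : E3) (s : ℝ) (x : E3) : ℝ := ‖x - x0‖ ^ 2 + s ^ 2

def Phi (x0 : E3) (s R : ℝ) (x : E3) : ℝ := F0 R (aa x0 s x)
def VV (x0 : E3) (s R : ℝ) (x : E3) : E3 := (2 * F1 R (aa x0 s x)) • (x - x0)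

lemma aa_pos {x0 : E3} {s : ℝ} (hs : 0 < s) (x : E3) : 0 < aa x0 s x := by
  unfold aa; positivity

lemma hasFDerivAt_aa (x0 : E3) (s : ℝ) (x : E3) :
    HasFDerivAt (aa x0 s) ((2 : ℝ) • innerSL ℝ (x - x0)) x := by
  have h1 : HasFDerivAt (fun x : E3 => x - x0) (ContinuousLinearMap.id ℝ E3) x :=
    (hasFDerivAt_id x).sub_const x0
  have := (h1.norm_sq).add_const (s ^ 2)
  refine this.congr_fderiv ?_
  ext; simp

lemma hasGradientAt_Phi (x0 : E3) {s : ℝ} (R : ℝ) (hs : 0 < s) (x : E3) :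
    HasGradientAt (Phi x0 s R) (VV x0 s R x) x := by
  rw [hasGradientAt_iff_hasFDerivAt]
  have := (hasDerivAt_F0 R (aa_pos (x0 := x0) hs x)).comp_hasFDerivAt x (hasFDerivAt_aa x0 s x)
  refine this.congr_fderiv ?_
  ext y
  simp [VV, real_inner_smul_left]
  ring

def DV (x0 : E3) (s R : ℝ) (x : E3) : E3 →L[ℝ] E3 :=
  (2 * F1 R (aa x0 s x)) • ContinuousLinearMap.id ℝ E3 +
    (4 * F2 R (aa x0 s x)) • (innerSL ℝ (x - x0)).smulRight (x - x0)

lemma hasFDerivAt_VV (x0 : E3) {s : ℝ} (R : ℝ) (hs : 0 < s) (x : E3) :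
    HasFDerivAt (VV x0 s R) (DV x0 s R x) x := by
  have h1 := ((hasDerivAt_F1 R (aa_pos (x0 := x0) hs x)).comp_hasFDerivAt x
    (hasFDerivAt_aa x0 s x)).const_mul 2
  have h2 : HasFDerivAt (fun x : E3 => x - x0) (ContinuousLinearMap.id ℝ E3) x :=
    (hasFDerivAt_id x).sub_const x0
  have := h1.smul h2
  refine this.congr_fderiv ?_
  ext y
  simp [DV]
  ring

/-- `√a` -/
def pp (x0 : E3) (s : ℝ) (x : E3) : ℝ := Real.sqrt (aa x0 s x)
def tt (x0 : E3) (s R : ℝ) (x : E3) : ℝ := th R (aa x0 s x)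

lemma si_aa (x0 : E3) (s : ℝ) (x : E3) : si (aa x0 s x) = (pp x0 s x)⁻¹ := rfl
lemma pp_pos {x0 : E3} {s : ℝ} (hs : 0 < s) (x : E3) : 0 < pp x0 s x := Real.sqrt_pos.2 (aa_pos hs x)
lemma pp_sq (x0 : E3) (s : ℝ) (x : E3) : pp x0 s x ^ 2 = ‖x - x0‖ ^ 2 + s ^ 2 :=
  Real.sq_sqrt (by unfold aa; positivity)
lemma norm_le_pp (x0 : E3) (s : ℝ) (x : E3) : ‖x - x0‖ ≤ pp x0 s x := by
  apply Real.le_sqrt_of_sq_le; unfold aa; nlinarith [sq_nonneg s]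
lemma s_le_pp (x0 : E3) (s : ℝ) (x : E3) : s ≤ pp x0 s x := by
  apply Real.le_sqrt_of_sq_le; unfold aa; nlinarith [sq_nonneg ‖x - x0‖]
lemma tt_nonneg (x0 : E3) (s R : ℝ) (x : E3) : 0 ≤ tt x0 s R x := th_nonneg _ _
lemma tt_le_one (x0 : E3) (s R : ℝ) (x : E3) : tt x0 s R x ≤ 1 := th_le_one (by unfold aa; positivity)

lemma tt_eq (x0 : E3) (s R : ℝ) (x : E3) : tt x0 s R x = max 0 (1 - pp x0 s x ^ 2 * (R ^ 2)⁻¹) := by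
  unfold tt th; rw [pp_sq]; rfl

lemma Phi_eq (x0 : E3) (s R : ℝ) (x : E3) : Phi x0 s R x = (pp x0 s x)⁻¹ * tt x0 s R x ^ 3 := rfl

lemma abs_F1 {x0 : E3} {s R : ℝ} (x : E3) : |F1 R (aa x0 s x)| =
    1 / 2 * (pp x0 s x)⁻¹ ^ 3 * tt x0 s R x ^ 3 + 3 * (R ^ 2)⁻¹ * (pp x0 s x)⁻¹ * tt x0 s R x ^ 2 := by
  have h0 := tt_nonneg x0 s R x
  have hp : 0 ≤ pp x0 s x := Real.sqrt_nonneg _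
  have : F1 R (aa x0 s x) = -(1 / 2 * (pp x0 s x)⁻¹ ^ 3 * tt x0 s R x ^ 3 +
      3 * (R ^ 2)⁻¹ * (pp x0 s x)⁻¹ * tt x0 s R x ^ 2) := by
    unfold F1; rw [si_aa]; change _ = -(_ * th R (aa x0 s x) ^ 3 + _ * th R (aa x0 s x) ^ 2); ring
  rw [this, abs_neg, abs_of_nonneg (by positivity)]

lemma norm_VV_le {x0 : E3} {s R : ℝ} (hs : 0 < s) (x : E3) : ‖VV x0 s R x‖ ≤
    (pp x0 s x)⁻¹ ^ 2 * tt x0 s R x ^ 3 + 6 * (R ^ 2)⁻¹ * tt x0 s R x ^ 2 := by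
  have hp := pp_pos (x0 := x0) hs x
  have h0 := tt_nonneg x0 s R x
  unfold VV
  rw [norm_smul, Real.norm_eq_abs, abs_mul, abs_F1, abs_two]
  calc _ ≤ 2 * (1 / 2 * (pp x0 s x)⁻¹ ^ 3 * tt x0 s R x ^ 3 +
        3 * (R ^ 2)⁻¹ * (pp x0 s x)⁻¹ * tt x0 s R x ^ 2) * pp x0 s x := by
        gcongr; exact norm_le_pp _ _ _
    _ = _ := by field_simp; ring

lemma F2_eq {x0 : E3} {s R : ℝ} (x : E3) : F2 R (aa x0 s x) = 3 / 4 * (pp x0 s x)⁻¹ ^ 5 * tt x0 s R x ^ 3 +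
    3 * (R ^ 2)⁻¹ * (pp x0 s x)⁻¹ ^ 3 * tt x0 s R x ^ 2
  + 6 * (R ^ 2)⁻¹ ^ 2 * (pp x0 s x)⁻¹ * tt x0 s R x := rfl

lemma norm_DV_le {x0 : E3} {s R : ℝ} (hs : 0 < s) (x : E3) : ‖DV x0 s R x‖ ≤
    4 * (pp x0 s x)⁻¹ ^ 3 * tt x0 s R x ^ 3 + 18 * (R ^ 2)⁻¹ * (pp x0 s x)⁻¹ * tt x0 s R x ^ 2 +
      24 * (R ^ 2)⁻¹ ^ 2 * pp x0 s x * tt x0 s R x := by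
  have hp := pp_pos (x0 := x0) hs x
  have h0 := tt_nonneg x0 s R x
  have hF2 : 0 ≤ F2 R (aa x0 s x) := by rw [F2_eq]; positivity
  have hb : 0 ≤ 4 * (pp x0 s x)⁻¹ ^ 3 * tt x0 s R x ^ 3 +
    18 * (R ^ 2)⁻¹ * (pp x0 s x)⁻¹ * tt x0 s R x ^ 2 +
      24 * (R ^ 2)⁻¹ ^ 2 * pp x0 s x * tt x0 s R x := by positivity
  refine ContinuousLinearMap.opNorm_le_bound _ hb fun y => ?_
  have e : DV x0 s R x y = (2 * F1 R (aa x0 s x)) • y + (4 * F2 R (aa x0 s x) * ⟪x - x0, y⟫) • (x - x0) := by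
    simp only [DV, add_apply, smul_apply, ContinuousLinearMap.id_apply, ContinuousLinearMap.smulRight_apply, innerSL_apply_apply, smul_smul]
  have h1 : |⟪x - x0, y⟫| ≤ pp x0 s x * ‖y‖ :=
    (abs_real_inner_le_norm _ _).trans (by gcongr; exact norm_le_pp _ _ _)
  calc ‖DV x0 s R x y‖ ≤ 2 * |F1 R (aa x0 s x)| * ‖y‖ + 4 * F2 R (aa x0 s x) * |⟪x - x0, y⟫| * ‖x - x0‖ := by
        rw [e]
        refine (norm_add_le _ _).trans (le_of_eq ?_)
        rw [norm_smul, norm_smul, Real.norm_eq_abs, Real.norm_eq_abs, abs_mul, abs_mul, abs_mul, abs_two,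
          abs_of_nonneg hF2]
        norm_num
    _ ≤ 2 * |F1 R (aa x0 s x)| * ‖y‖ + 4 * F2 R (aa x0 s x) * (pp x0 s x * ‖y‖) * pp x0 s x := by
        gcongr
        exact norm_le_pp _ _ _
    _ = _ := by
        rw [abs_F1, F2_eq]
        field_simp
        ring

lemma lap_le {x0 : E3} {s R : ℝ} (hs : 0 < s) (x : E3) :
    6 * F1 R (aa x0 s x) + 4 * F2 R (aa x0 s x) * ‖x - x0‖ ^ 2 ≤
      -3 * s ^ 2 * (pp x0 s x)⁻¹ ^ 5 * tt x0 s R x ^ 3 + 24 * (R ^ 2)⁻¹ ^ 2 * pp x0 s x * tt x0 s R x := by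
  have hp := pp_pos (x0 := x0) hs x
  have h0 := tt_nonneg x0 s R x
  have e : F1 R (aa x0 s x) = -(1 / 2 * (pp x0 s x)⁻¹ ^ 3 * tt x0 s R x ^ 3 +
      3 * (R ^ 2)⁻¹ * (pp x0 s x)⁻¹ * tt x0 s R x ^ 2) := by
    unfold F1; rw [si_aa]; change _ = -(_ * th R (aa x0 s x) ^ 3 + _ * th R (aa x0 s x) ^ 2); ring
  have e2 : ‖x - x0‖ ^ 2 = pp x0 s x ^ 2 - s ^ 2 := by rw [pp_sq]; ring
  rw [e, F2_eq, e2]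
  set p := pp x0 s x
  set θ := tt x0 s R x
  have : 0 ≤ 6 * (R ^ 2)⁻¹ * p⁻¹ * θ ^ 2 + s ^ 2 * (12 * (R ^ 2)⁻¹ * p⁻¹ ^ 3 * θ ^ 2
    + 24 * (R ^ 2)⁻¹ ^ 2 * p⁻¹ * θ) := by positivity
  have e3 : 6 * -(1 / 2 * p⁻¹ ^ 3 * θ ^ 3 + 3 * (R ^ 2)⁻¹ * p⁻¹ * θ ^ 2) +
      4 * (3 / 4 * p⁻¹ ^ 5 * θ ^ 3 + 3 * (R ^ 2)⁻¹ * p⁻¹ ^ 3 * θ ^ 2 + 6 * (R ^ 2)⁻¹ ^ 2 * p⁻¹ * θ) *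
        (p ^ 2 - s ^ 2) = -3 * s ^ 2 * p⁻¹ ^ 5 * θ ^ 3 + 24 * (R ^ 2)⁻¹ ^ 2 * p * θ -
      (6 * (R ^ 2)⁻¹ * p⁻¹ * θ ^ 2 + s ^ 2 * (12 * (R ^ 2)⁻¹ * p⁻¹ ^ 3 * θ ^ 2
    + 24 * (R ^ 2)⁻¹ ^ 2 * p⁻¹ * θ)) := by
    generalize (R ^ 2)⁻¹ = ρ
    field_simp
    ring
  rw [e3]; linarith

end PB

namespace PB

lemma intg_of {f : E3 → ℝ} (hf : Measurable f) {x0 : E3} {ρ M : ℝ}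
    (h0 : ∀ x, x ∉ closedBall x0 ρ → f x = 0) (hM : ∀ x ∈ closedBall x0 ρ, |f x| ≤ M) :
    Integrable f := by
  have h1 : IntegrableOn f (closedBall x0 ρ) := by
    apply IntegrableOn.of_bound measure_closedBall_lt_top hf.aestronglyMeasurable M
    filter_upwards [ae_restrict_mem measurableSet_closedBall] with x hx
    exact hM x hx
  exact (integrableOn_iff_integrable_of_support_subset (fun x hx => by
    by_contra h; exact hx (h0 x h))).1 h1

lemma lip_mul {U g : E3 → ℝ} {K L : ℝ≥0} (hU : LipschitzWith K U) (hg : LipschitzWith L g)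
    {x0 : E3} {ρ M G : ℝ} (h0 : ∀ x, x ∉ closedBall x0 ρ → g x = 0)
    (hM : ∀ x ∈ closedBall x0 ρ, |U x| ≤ M) (hG : ∀ x, |g x| ≤ G) (hM0 : 0 ≤ M) (hG0 : 0 ≤ G) :
    LipschitzWith ⟨M * L + G * K, by positivity⟩ (fun x => U x * g x) := by
  apply LipschitzWith.of_dist_le_mul
  have main : ∀ x y, x ∈ closedBall x0 ρ → |U x * g x - U y * g y| ≤ (M * L + G * K) * dist x y := by
    intro x y hx
    have e : U x * g x - U y * g y = U x * (g x - g y) + g y * (U x - U y) := by ring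
    have a1 := hU.dist_le_mul x y
    have a2 := hg.dist_le_mul x y
    rw [Real.dist_eq] at a1 a2
    rw [e]
    refine (abs_add_le _ _).trans ?_
    rw [abs_mul, abs_mul]
    have := mul_le_mul (hM x hx) a2 (abs_nonneg _) hM0
    have := mul_le_mul (hG y) a1 (abs_nonneg _) hG0
    nlinarith
  intro x y
  rw [Real.dist_eq]
  by_cases hx : x ∈ closedBall x0 ρ
  · exact main x y hx
  · by_cases hy : y ∈ closedBall x0 ρ
    · rw [abs_sub_comm, dist_comm]; exact main y x hy
    · rw [h0 x hx, h0 y hy]; simp only [mul_zero, sub_self, abs_zero]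
      exact mul_nonneg (NNReal.coe_nonneg _) dist_nonneg

lemma grad_coord {U : E3 → ℝ} (x : E3) (i : Fin 3) :
    fderiv ℝ U x (EuclideanSpace.single i 1) = gradient U x i := by
  have h : fderiv ℝ U x = InnerProductSpace.toDual ℝ E3 (gradient U x) := by
    unfold gradient; simp
  rw [h, InnerProductSpace.toDual_apply_apply, EuclideanSpace.inner_single_right]
  simp

lemma ibp_coord {U g : E3 → ℝ} {K : ℝ≥0} (hU : LipschitzWith K U) {g' : E3 → (E3 →L[ℝ] ℝ)}
    (hg : ∀ x, HasFDerivAt g (g' x) x) {L : ℝ} (hL : ∀ x, ‖g' x‖ ≤ L) {x0 : E3} {ρ : ℝ}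
    (h0 : ∀ x, x ∉ closedBall x0 ρ → g x = 0) (i : Fin 3) :
    Integrable (fun x => U x * (gradient U x i * g x)) ∧
    Integrable (fun x => U x ^ 2 * g' x (EuclideanSpace.single i 1)) ∧
    2 * ∫ x, U x * (gradient U x i * g x) = - ∫ x, U x ^ 2 * g' x (EuclideanSpace.single i 1) := by
  have hL0 : 0 ≤ L := (norm_nonneg _).trans (hL x0)
  have hgl : LipschitzWith ⟨L, hL0⟩ g := by
    have : g' = fderiv ℝ g := by funext x; exact (hg x).fderiv.symm
    apply lipschitzWith_of_nnnorm_fderiv_le (𝕜 := ℝ) (fun x => (hg x).differentiableAt)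
    intro x
    rw [← this]; exact hL x
  have hgs : HasCompactSupport g := HasCompactSupport.intro (isCompact_closedBall x0 ρ) (h0 · ·)
  obtain ⟨G, hG⟩ := hgs.exists_bound_of_continuous hgl.continuous
  have hG0 : 0 ≤ G := (norm_nonneg _).trans (hG x0)
  obtain ⟨M', hM'⟩ := (isCompact_closedBall x0 ρ).exists_bound_of_continuousOn hU.continuous.continuousOn
  set M := max M' 0
  have hM : ∀ x ∈ closedBall x0 ρ, |U x| ≤ M := fun x hx => (hM' x hx).trans (le_max_left _ _)
  have hM0 : 0 ≤ M := le_max_right _ _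
  have hUg := lip_mul hU hgl h0 hM hG hM0 hG0
  have hUgs : HasCompactSupport (fun x => U x * g x) :=
    HasCompactSupport.intro (isCompact_closedBall x0 ρ) (fun x hx => by rw [h0 x hx, mul_zero])
  have key := hU.integral_lineDeriv_mul_eq (μ := volume) hUg hUgs (EuclideanSpace.single i 1)
  have hgi : ∀ x, |gradient U x i| ≤ K := fun x =>
    (PiLp.norm_apply_le (gradient U x) i).trans (norm_gradient_le hU x)
  have hmi : Measurable (fun x => gradient U x i) := by
    have := measurable_gradient U
    fun_prop
  have hg'0 : ∀ x, x ∉ closedBall x0 ρ → g' x = 0 := by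
    intro x hx
    have : g =ᶠ[nhds x] fun _ => 0 := by
      filter_upwards [isClosed_closedBall.isOpen_compl.mem_nhds hx] with y hy
      exact h0 y hy
    exact (hg x).unique ((hasFDerivAt_const (0 : ℝ) x).congr_of_eventuallyEq this)
  have hg'e : ∀ x, |g' x (EuclideanSpace.single i 1)| ≤ L := by
    intro x
    refine ((g' x).le_opNorm _).trans ?_
    simpa using hL x
  have hg'm : Measurable (fun x => g' x (EuclideanSpace.single i 1)) := by
    have : g' = fderiv ℝ g := by funext x; exact (hg x).fderiv.symm
    rw [this]
    exact measurable_fderiv_apply_const ℝ g _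
  have I1 : Integrable (fun x => U x * (gradient U x i * g x)) := by
    refine intg_of (x0 := x0) (ρ := ρ) (M := M * (K * G)) ?_ (fun x hx => by rw [h0 x hx]; simp) ?_
    · exact hU.continuous.measurable.mul (hmi.mul hgl.continuous.measurable)
    · intro x hx
      rw [abs_mul, abs_mul]
      exact mul_le_mul (hM x hx) (mul_le_mul (hgi x) (hG x) (abs_nonneg _) K.2)
        (by positivity) hM0
  have I2 : Integrable (fun x => U x ^ 2 * g' x (EuclideanSpace.single i 1)) := by
    refine intg_of (x0 := x0) (ρ := ρ) (M := M ^ 2 * L) ?_ (fun x hx => by rw [hg'0 x hx]; simp) ?_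
    · exact (hU.continuous.measurable.pow_const 2).mul hg'm
    · intro x hx
      rw [abs_mul, abs_pow]
      exact mul_le_mul (pow_le_pow_left₀ (abs_nonneg _) (hM x hx) 2) (hg'e x) (abs_nonneg _) (by positivity)
  refine ⟨I1, I2, ?_⟩
  have hd := hU.ae_differentiableAt (μ := volume)
  have e1 : ∫ x, lineDeriv ℝ U x (EuclideanSpace.single i 1) * (U x * g x) =
      ∫ x, U x * (gradient U x i * g x) := by
    apply integral_congr_ae
    filter_upwards [hd] with x hx
    rw [hx.lineDeriv_eq_fderiv, grad_coord]; ring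
  have e2 : ∫ x, lineDeriv ℝ (fun x => U x * g x) x (-EuclideanSpace.single i 1) * U x =
      ∫ x, (-(U x * (gradient U x i * g x)) - U x ^ 2 * g' x (EuclideanSpace.single i 1)) := by
    apply integral_congr_ae
    filter_upwards [hd] with x hx
    have h1 := hx.hasFDerivAt.mul (hg x)
    have h2 : lineDeriv ℝ (fun x => U x * g x) x (-EuclideanSpace.single i 1) =
      (U x • g' x + g x • fderiv ℝ U x) (-EuclideanSpace.single i 1) := by
      have := h1.hasLineDerivAt (-EuclideanSpace.single i 1)
      exact this.lineDeriv
    rw [h2]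
    simp only [map_neg, add_apply, smul_apply, smul_eq_mul, grad_coord]
    ring
  have e3 := integral_sub (f := fun x => -(U x * (gradient U x i * g x))) I1.neg I2
  rw [e1, e2, e3, integral_neg] at key
  linarith

lemma ibp {U : E3 → ℝ} {K : ℝ≥0} (hU : LipschitzWith K U) {V : E3 → E3} {V' : E3 → (E3 →L[ℝ] E3)}
    (hV : ∀ x, HasFDerivAt V (V' x) x) {L : ℝ} (hL : ∀ x, ‖V' x‖ ≤ L) {x0 : E3} {ρ : ℝ}
    (h0 : ∀ x, x ∉ closedBall x0 ρ → V x = 0) :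
    Integrable (fun x => U x * ⟪gradient U x, V x⟫) ∧
    Integrable (fun x => U x ^ 2 * ∑ i : Fin 3, V' x (EuclideanSpace.single i 1) i) ∧
    2 * ∫ x, U x * ⟪gradient U x, V x⟫ =
      - ∫ x, U x ^ 2 * ∑ i : Fin 3, V' x (EuclideanSpace.single i 1) i := by
  have H := fun i : Fin 3 => ibp_coord hU (g := fun x => V x i)
    (g' := fun x => (EuclideanSpace.proj i : E3 →L[ℝ] ℝ).comp (V' x))
    (fun x => ((EuclideanSpace.proj i : E3 →L[ℝ] ℝ).hasFDerivAt).comp x (hV x)) (L := L)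
    (fun x => by
      refine ContinuousLinearMap.opNorm_le_bound _ ((norm_nonneg _).trans (hL x)) fun y => ?_
      refine (PiLp.norm_apply_le (V' x y) i).trans ?_
      refine ((V' x).le_opNorm y).trans ?_
      gcongr; exact hL x)
    (x0 := x0) (ρ := ρ) (fun x hx => by simp [h0 x hx]) i
  have e1 : ∀ x, U x * ⟪gradient U x, V x⟫ = ∑ i : Fin 3, U x * (gradient U x i * V x i) := by
    intro x
    rw [← Finset.mul_sum, PiLp.inner_apply]
    congr 1
    refine Finset.sum_congr rfl fun i _ => ?_
    simp [mul_comm]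
  have e2 : ∀ x, U x ^ 2 * ∑ i : Fin 3, V' x (EuclideanSpace.single i 1) i =
      ∑ i : Fin 3, U x ^ 2 * V' x (EuclideanSpace.single i 1) i := by
    intro x; rw [Finset.mul_sum]
  simp_rw [e1, e2]
  refine ⟨integrable_finsetSum _ fun i _ => (H i).1, integrable_finsetSum _ fun i _ => (H i).2.1, ?_⟩
  have e4 : ∫ x, ∑ i : Fin 3, U x ^ 2 * V' x (EuclideanSpace.single i 1) i =
      ∑ i : Fin 3, ∫ x, U x ^ 2 * V' x (EuclideanSpace.single i 1) i :=
    integral_finsetSum _ (fun i _ => (H i).2.1)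
  rw [integral_finsetSum _ (fun i _ => (H i).1), e4, Finset.mul_sum, ← Finset.sum_neg_distrib]
  exact Finset.sum_congr rfl fun i _ => (H i).2.2

lemma trace_DV (x0 : E3) (s R : ℝ) (x : E3) :
    ∑ i : Fin 3, DV x0 s R x (EuclideanSpace.single i 1) i =
      6 * F1 R (aa x0 s x) + 4 * F2 R (aa x0 s x) * ‖x - x0‖ ^ 2 := by
  have e : ∀ i : Fin 3, DV x0 s R x (EuclideanSpace.single i 1) i =
      2 * F1 R (aa x0 s x) + 4 * F2 R (aa x0 s x) * ((x - x0) i) ^ 2 := by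
    intro i
    have h1 : ⟪x - x0, EuclideanSpace.single i (1 : ℝ)⟫ = (x - x0) i := by
      simp [EuclideanSpace.inner_single_right]
    simp only [DV, add_apply, smul_apply, ContinuousLinearMap.id_apply,
      ContinuousLinearMap.smulRight_apply, innerSL_apply_apply, h1]
    simp only [PiLp.add_apply, PiLp.smul_apply, smul_eq_mul, EuclideanSpace.single_apply, if_true]
    ring
  simp_rw [e]
  rw [EuclideanSpace.norm_sq_eq]
  simp only [Fin.sum_univ_three, Real.norm_eq_abs, sq_abs]
  ring

end PB

namespace PB

set_option maxHeartbeats 1000000 in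
lemma arith {C0 ε : ℝ} (hC0 : 0 < C0) (hε : 0 < ε) : ∃ K0 C : ℝ, 2 ≤ K0 ∧ 0 < C ∧ ∀ K h R P Q Θ A B : ℝ,
    K0 ≤ K → 0 < h → h * P * K ≤ 1 → h * Q ≤ 1 → Q ≤ 2 * P → 0 < P → 0 < Q → 0 ≤ Θ → Θ ≤ 5 →
    0 ≤ A → 0 ≤ B → h * A ≤ C0 * B →
    h * (4 * P ^ 2 * Θ ^ 3 + 6 * Q ^ 2 * Θ ^ 2) * A ^ 2 +
      h * (32 * P ^ 3 * Θ ^ 3 + 36 * P * Q ^ 2 * Θ ^ 2 + 48 * Q ^ 3 * Θ) * (A * B) ≤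
    ε * (P * Θ ^ 3 * A ^ 2 + (K * h) ^ 2 * P ^ 5 * Θ ^ 3 * B ^ 2) + C * Q ^ 3 * B ^ 2 := by
  set δ := ε / 92 with hδ
  have hδ0 : 0 < δ := by positivity
  refine ⟨2 + 8 / ε + 16 / (δ * ε), 6 * δ⁻¹ ^ 2 * C0 ^ 2 + 90 * δ⁻¹ + 240 * C0, ?_, by positivity, ?_⟩
  · have : 0 < 8 / ε + 16 / (δ * ε) := by positivity
    linarith
  intro K h R P Q Θ A B hK hh hPK hhQ hQP hP hQ hΘ hΘ5 hA hB hAB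
  have hK2 : 2 ≤ K := by
    have : 0 < 8 / ε + 16 / (δ * ε) := by positivity
    linarith
  have hK8 : 8 ≤ ε * K := by
    have : 8 / ε ≤ K := by
      have : 0 < 16 / (δ * ε) := by positivity
      linarith
    rw [div_le_iff₀ hε] at this; linarith
  have hK16 : 16 ≤ δ * ε * K := by
    have : 16 / (δ * ε) ≤ K := by
      have : 0 < 8 / ε := by positivity
      linarith
    rw [div_le_iff₀ (by positivity)] at this; linarith
  have hhP : h * P ≤ 1 := by
    have : 0 < h * P := by positivity
    nlinarith
  have hhP8 : 8 * (h * P) ≤ ε := by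
    have : 8 * (h * P) ≤ ε * K * (h * P) := by gcongr
    calc 8 * (h * P) ≤ ε * K * (h * P) := this
      _ = ε * (h * P * K) := by ring
      _ ≤ ε * 1 := by gcongr
      _ = ε := mul_one _
  have hsq : (h * A) ^ 2 ≤ (C0 * B) ^ 2 := pow_le_pow_left₀ (by positivity) hAB 2
  -- T1
  have T1 : h * (4 * P ^ 2 * Θ ^ 3) * A ^ 2 ≤ ε / 2 * (P * Θ ^ 3 * A ^ 2) := by
    calc h * (4 * P ^ 2 * Θ ^ 3) * A ^ 2 = (8 * (h * P)) / 2 * (P * Θ ^ 3 * A ^ 2) := by ring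
      _ ≤ _ := by gcongr
  -- T2
  have hy : (h * Q) * Θ ^ 2 ≤ δ * Θ ^ 3 + δ⁻¹ ^ 2 * (h * Q) ^ 3 := by
    have hq : 0 < h * Q := by positivity
    rcases le_total (h * Q) (δ * Θ) with hc | hc
    · have : (h * Q) * Θ ^ 2 ≤ (δ * Θ) * Θ ^ 2 := by gcongr
      have : 0 ≤ δ⁻¹ ^ 2 * (h * Q) ^ 3 := by positivity
      nlinarith
    · have h1 : Θ ≤ δ⁻¹ * (h * Q) := by
        rw [inv_mul_eq_div, le_div_iff₀ hδ0]; linarith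
      have : (h * Q) * Θ ^ 2 ≤ (h * Q) * (δ⁻¹ * (h * Q)) ^ 2 := by gcongr
      have : 0 ≤ δ * Θ ^ 3 := by positivity
      nlinarith
  have T2 : h * (6 * Q ^ 2 * Θ ^ 2) * A ^ 2 ≤ 12 * δ * (P * Θ ^ 3 * A ^ 2) +
      6 * δ⁻¹ ^ 2 * C0 ^ 2 * Q ^ 3 * B ^ 2 := by
    calc h * (6 * Q ^ 2 * Θ ^ 2) * A ^ 2 = 6 * Q * A ^ 2 * ((h * Q) * Θ ^ 2) := by ring
      _ ≤ 6 * Q * A ^ 2 * (δ * Θ ^ 3 + δ⁻¹ ^ 2 * (h * Q) ^ 3) := by gcongr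
      _ = 6 * δ * (Q * Θ ^ 3 * A ^ 2) + 6 * δ⁻¹ ^ 2 * Q ^ 3 * (h * Q) * (h * A) ^ 2 := by ring
      _ ≤ 6 * δ * ((2 * P) * Θ ^ 3 * A ^ 2) + 6 * δ⁻¹ ^ 2 * Q ^ 3 * 1 * (C0 * B) ^ 2 := by gcongr
      _ = _ := by ring
  have T3 : h * (32 * P ^ 3 * Θ ^ 3) * (A * B) ≤ 16 * δ * (P * Θ ^ 3 * A ^ 2) +
      ε * ((K * h) ^ 2 * P ^ 5 * Θ ^ 3 * B ^ 2) := by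
    have h1 : 0 ≤ 16 * P * Θ ^ 3 * δ⁻¹ * (δ * A - h * P ^ 2 * B) ^ 2 := by positivity
    have e1 : 16 * P * Θ ^ 3 * δ⁻¹ * (δ * A - h * P ^ 2 * B) ^ 2 =
      16 * δ * (P * Θ ^ 3 * A ^ 2) - h * (32 * P ^ 3 * Θ ^ 3) * (A * B) +
        16 * δ⁻¹ * (h ^ 2 * P ^ 5 * Θ ^ 3 * B ^ 2) := by
      field_simp; ring
    have e2 : 16 * δ⁻¹ ≤ ε * K ^ 2 := by
      rw [← div_eq_mul_inv, div_le_iff₀ hδ0]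
      nlinarith [mul_pos hδ0 hε]
    have e3 : 16 * δ⁻¹ * (h ^ 2 * P ^ 5 * Θ ^ 3 * B ^ 2) ≤ ε * K ^ 2 * (h ^ 2 * P ^ 5 * Θ ^ 3 * B ^ 2) := by
      gcongr
    linarith
  have T4 : h * (36 * P * Q ^ 2 * Θ ^ 2) * (A * B) ≤ 18 * δ * (P * Θ ^ 3 * A ^ 2) +
      90 * δ⁻¹ * Q ^ 3 * B ^ 2 := by
    have h1 : 0 ≤ 18 * P * Θ * δ⁻¹ * (δ * Θ * A - h * Q ^ 2 * B) ^ 2 := by positivity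
    have e1 : 18 * P * Θ * δ⁻¹ * (δ * Θ * A - h * Q ^ 2 * B) ^ 2 =
      18 * δ * (P * Θ ^ 3 * A ^ 2) - h * (36 * P * Q ^ 2 * Θ ^ 2) * (A * B) +
        18 * δ⁻¹ * ((h * P) * (h * Q) * Q ^ 3 * Θ * B ^ 2) := by
      field_simp; ring
    have e3 : 18 * δ⁻¹ * ((h * P) * (h * Q) * Q ^ 3 * Θ * B ^ 2) ≤
        18 * δ⁻¹ * (1 * 1 * Q ^ 3 * 5 * B ^ 2) := by
      gcongr
    linarith
  have T5 : h * (48 * Q ^ 3 * Θ) * (A * B) ≤ 240 * C0 * Q ^ 3 * B ^ 2 := by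
    calc h * (48 * Q ^ 3 * Θ) * (A * B) = 48 * Q ^ 3 * Θ * B * (h * A) := by ring
      _ ≤ 48 * Q ^ 3 * 5 * B * (C0 * B) := by gcongr
      _ = _ := by ring
  have hcoef : ε / 2 + 12 * δ + 16 * δ + 18 * δ = ε := by rw [hδ]; ring
  have hfin : ε * (P * Θ ^ 3 * A ^ 2) = (ε / 2 + 12 * δ + 16 * δ + 18 * δ) * (P * Θ ^ 3 * A ^ 2) := by
    rw [hcoef]
  linarith

lemma pp_lip {x0 : E3} {s : ℝ} (hs : 0 < s) (x y : E3) : pp x0 s x ≤ pp x0 s y + ‖x - y‖ := by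
  have h1 := pp_sq x0 s x
  have h2 := pp_sq x0 s y
  have hx := norm_le_pp x0 s x
  have hy := norm_le_pp x0 s y
  have px := pp_pos (x0 := x0) hs x
  have py := pp_pos (x0 := x0) hs y
  have tri : ‖x - x0‖ ≤ ‖y - x0‖ + ‖x - y‖ := by
    have := norm_add_le (y - x0) (x - y)
    rwa [show y - x0 + (x - y) = x - x0 by abel] at this
  have n1 := norm_nonneg (x - y)
  by_contra hcon
  push Not at hcon
  have : (pp x0 s y + ‖x - y‖) ^ 2 < pp x0 s x ^ 2 := pow_lt_pow_left₀ hcon (by positivity) two_ne_zero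
  have := pow_le_pow_left₀ (norm_nonneg _) tri 2
  nlinarith

/-- geometric comparison facts on a touching tetrahedron -/
lemma geom {x0 : E3} {s R h : ℝ} (hh : 0 < h) (hs : 2 * h ≤ s) (hsR : s ≤ R)
    {v : Fin 4 → E3} (hd : Metric.diam (tet v) ≤ h) (htouch : ∃ y ∈ tet v, tt x0 s R y ≠ 0) :
    (∀ y ∈ tet v, pp x0 s y ≤ 2 * R) ∧
    (∀ y ∈ tet v, ∀ z ∈ tet v, pp x0 s y ≤ 2 * pp x0 s z) ∧
    (∀ y ∈ tet v, ∀ z ∈ tet v, tt x0 s R y ≤ tt x0 s R z + 4 * (h * R⁻¹)) := by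
  have hs0 : 0 < s := by linarith
  have hR0 : 0 < R := by linarith
  obtain ⟨y1, hy1, ht1⟩ := htouch
  have hp1 : pp x0 s y1 ≤ R := by
    by_contra hcon
    push Not at hcon
    apply ht1
    rw [tt_eq]
    apply max_eq_left
    have : 1 ≤ pp x0 s y1 ^ 2 * (R ^ 2)⁻¹ := by
      rw [← div_eq_mul_inv, le_div_iff₀ (by positivity)]
      nlinarith
    linarith
  have G1 : ∀ y ∈ tet v, pp x0 s y ≤ 2 * R := by
    intro y hy
    have := pp_lip hs0 (x0 := x0) y y1
    have := tet_dist hd hy hy1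
    linarith
  have G2 : ∀ y ∈ tet v, ∀ z ∈ tet v, pp x0 s y ≤ 2 * pp x0 s z := by
    intro y hy z hz
    have := pp_lip hs0 (x0 := x0) y z
    have := tet_dist hd hy hz
    have := s_le_pp x0 s z
    linarith
  refine ⟨G1, G2, ?_⟩
  intro y hy z hz
  rw [tt_eq, tt_eq]
  have h1 := pp_lip hs0 (x0 := x0) z y
  have h2 := tet_dist hd hz hy
  have h3 := G1 y hy
  have h4 := G1 z hz
  have py := pp_pos (x0 := x0) hs0 y
  have pz := pp_pos (x0 := x0) hs0 z
  apply max_le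
  · have := le_max_left 0 (1 - pp x0 s z ^ 2 * (R ^ 2)⁻¹)
    have : 0 < h * R⁻¹ := by positivity
    linarith
  · have h5 := le_max_right 0 (1 - pp x0 s z ^ 2 * (R ^ 2)⁻¹)
    have h6 : (pp x0 s z ^ 2 - pp x0 s y ^ 2) * (R ^ 2)⁻¹ ≤ 4 * (h * R⁻¹) := by
      have e : 4 * (h * R⁻¹) = (4 * h * R) * (R ^ 2)⁻¹ := by field_simp
      rw [e]
      apply mul_le_mul_of_nonneg_right _ (by positivity)
      nlinarith
    nlinarith

lemma DD_bounds {x0 : E3} {s R h : ℝ} (hh : 0 < h) (hs : 2 * h ≤ s) (hsR : s ≤ R)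
    {v : Fin 4 → E3} (hd : Metric.diam (tet v) ≤ h) (htouch : ∃ y ∈ tet v, tt x0 s R y ≠ 0)
    {y0 : E3} (hy0 : y0 ∈ tet v) {P Q Θ : ℝ} (hP : P = (pp x0 s y0)⁻¹) (hQ : Q = R⁻¹)
    (hΘ : Θ = tt x0 s R y0 + 4 * (h * R⁻¹)) :
    (∀ y ∈ tet v, ‖VV x0 s R y‖ ≤ 4 * P ^ 2 * Θ ^ 3 + 6 * Q ^ 2 * Θ ^ 2) ∧
    (∀ y ∈ tet v, ∀ z ∈ tet v, ‖VV x0 s R y - VV x0 s R z‖ ≤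
      (32 * P ^ 3 * Θ ^ 3 + 36 * P * Q ^ 2 * Θ ^ 2 + 48 * Q ^ 3 * Θ) * h) := by
  have hs0 : 0 < s := by linarith
  have hR0 : 0 < R := by linarith
  obtain ⟨G1, G2, G3⟩ := geom hh hs hsR hd htouch
  have p0 := pp_pos (x0 := x0) hs0 y0
  have hP0 : 0 < P := by rw [hP]; positivity
  have hQ0 : 0 < Q := by rw [hQ]; positivity
  have hpi : ∀ y ∈ tet v, (pp x0 s y)⁻¹ ≤ 2 * P := by
    intro y hy
    have := G2 y0 hy0 y hy
    have py := pp_pos (x0 := x0) hs0 y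
    rw [hP, inv_le_comm₀ py (by positivity), mul_inv, inv_inv]
    linarith
  have hQ2 : (R ^ 2)⁻¹ = Q ^ 2 := by rw [hQ]; field_simp
  have htΘ : ∀ y ∈ tet v, tt x0 s R y ≤ Θ := fun y hy => by rw [hΘ]; exact G3 y hy y0 hy0
  have hΘ0 : 0 ≤ Θ := (tt_nonneg _ _ _ _).trans (htΘ y0 hy0)
  constructor
  · intro y hy
    refine (norm_VV_le hs0 y).trans ?_
    have t0 := tt_nonneg x0 s R y
    have py := pp_pos (x0 := x0) hs0 y
    rw [hQ2]
    calc _ ≤ (2 * P) ^ 2 * Θ ^ 3 + 6 * Q ^ 2 * Θ ^ 2 := by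
          gcongr
          · exact hpi y hy
          · exact htΘ y hy
          · exact htΘ y hy
      _ = _ := by ring
  · intro y hy z hz
    have hDb : ∀ y ∈ tet v, ‖DV x0 s R y‖ ≤
        32 * P ^ 3 * Θ ^ 3 + 36 * P * Q ^ 2 * Θ ^ 2 + 48 * Q ^ 3 * Θ := by
      intro y hy
      refine (norm_DV_le hs0 y).trans ?_
      have t0 := tt_nonneg x0 s R y
      have py := pp_pos (x0 := x0) hs0 y
      rw [hQ2]
      calc _ ≤ 4 * (2 * P) ^ 3 * Θ ^ 3 + 18 * Q ^ 2 * (2 * P) * Θ ^ 2 + 24 * (Q ^ 2) ^ 2 * (2 * R) * Θ := by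
            gcongr
            · exact hpi y hy
            · exact htΘ y hy
            · exact hpi y hy
            · exact htΘ y hy
            · exact G1 y hy
            · exact htΘ y hy
        _ = _ := by
            have : Q * R = 1 := by rw [hQ]; exact inv_mul_cancel₀ hR0.ne'
            have e : 24 * (Q ^ 2) ^ 2 * (2 * R) * Θ = 48 * Q ^ 3 * (Q * R) * Θ := by ring
            rw [e, this]; ring
    have := (convex_tet v).norm_image_sub_le_of_norm_hasFDerivWithin_le (f := VV x0 s R)
      (f' := DV x0 s R) (fun x _ => (hasFDerivAt_VV x0 R hs0 x).hasFDerivWithinAt) hDb hz hy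
    refine this.trans ?_
    have h0 : 0 ≤ 32 * P ^ 3 * Θ ^ 3 + 36 * P * Q ^ 2 * Θ ^ 2 + 48 * Q ^ 3 * Θ := by positivity
    exact mul_le_mul_of_nonneg_left (tet_dist hd hy hz) h0

end PB

namespace PB

lemma continuous_aa (x0 : E3) (s : ℝ) : Continuous (aa x0 s) := by unfold aa; fun_prop
lemma continuous_pp (x0 : E3) (s : ℝ) : Continuous (pp x0 s) := by
  unfold pp; exact Real.continuous_sqrt.comp (continuous_aa x0 s)
lemma continuous_ppi (x0 : E3) {s : ℝ} (hs : 0 < s) : Continuous (fun x => (pp x0 s x)⁻¹) :=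
  (continuous_pp x0 s).inv₀ (fun x => (pp_pos hs x).ne')
lemma continuous_tt (x0 : E3) (s R : ℝ) : Continuous (tt x0 s R) := by
  have := continuous_aa x0 s
  unfold tt th; fun_prop
lemma continuous_VV (x0 : E3) {s : ℝ} (R : ℝ) (hs : 0 < s) : Continuous (VV x0 s R) :=
  continuous_iff_continuousAt.2 fun x => (hasFDerivAt_VV x0 R hs x).continuousAt
lemma continuous_Phi (x0 : E3) {s : ℝ} (R : ℝ) (hs : 0 < s) : Continuous (Phi x0 s R) := by
  have e : Phi x0 s R = fun x => (pp x0 s x)⁻¹ * tt x0 s R x ^ 3 := by funext x; exact Phi_eq _ _ _ _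
  rw [e]
  exact (continuous_ppi x0 hs).mul ((continuous_tt x0 s R).pow 3)

lemma io_tet {f : E3 → ℝ} (hf : Continuous f) (v : Fin 4 → E3) : IntegrableOn f (tet v) :=
  hf.continuousOn.integrableOn_compact (isCompact_tet v)

lemma inv2 (r : ℕ) {c : ℝ} (hc : 0 < c) : ∃ C B : ℝ, 0 < C ∧ 0 < B ∧ ∀ h : ℝ, 0 < h →
    ∀ (v : Fin 4 → E3) (z : E3), Metric.diam (tet v) ≤ h → closedBall z (c * h) ⊆ tet v →
    (volume (tet v)).toReal ≤ B * h ^ 3 ∧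
    ∀ (p : MvPolynomial (Fin 3) ℝ), p.totalDegree ≤ r →
    (∀ x ∈ tet v, (pev p x) ^ 2 ≤ C * (h ^ 3)⁻¹ * ∫ y in tet v, (pev p y) ^ 2) ∧
    (∀ x ∈ tet v, ‖pgrad p x‖ ^ 2 ≤ C * (h ^ 3)⁻¹ * ∫ y in tet v, ‖pgrad p y‖ ^ 2) ∧
    h ^ 2 * (∫ y in tet v, ‖pgrad p y‖ ^ 2) ≤ C * B * ∫ y in tet v, (pev p y) ^ 2 := by
  obtain ⟨C, hC, hinv⟩ := inv_est r hc
  obtain ⟨B, hB, hvol⟩ := vol_cb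
  refine ⟨C, B, hC, hB, ?_⟩
  intro h hh v z hd hz
  have hsub := tet_sub_ball hd (by positivity) hz
  have hv := hvol z h hh _ hsub
  refine ⟨hv, ?_⟩
  intro p hp
  have hns : ∀ x, ‖pgrad p x‖ ^ 2 = ∑ i : Fin 3, (pev (MvPolynomial.pderiv i p) x) ^ 2 := by
    intro x
    rw [EuclideanSpace.norm_sq_eq]
    simp [pgrad]
  have hI := fun x hx => hinv h hh z (tet v) (isCompact_tet v) hz hsub p hp x hx
  refine ⟨fun x hx => (hI x hx).1, ?_, ?_⟩
  · intro x hx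
    have e : ∫ y in tet v, ‖pgrad p y‖ ^ 2 =
        ∑ i : Fin 3, ∫ y in tet v, (pev (MvPolynomial.pderiv i p) y) ^ 2 := by
      simp_rw [hns]
      rw [integral_finsetSum]
      intro i _
      exact io_tet ((continuous_pev _).pow 2) v
    rw [hns, e, Finset.mul_sum]
    apply Finset.sum_le_sum
    intro i _
    exact (hinv h hh z (tet v) (isCompact_tet v) hz hsub _
      ((totalDegree_pderiv_le i p).trans hp) x hx).1
  · have hY : 0 ≤ ∫ y in tet v, (pev p y) ^ 2 := integral_nonneg fun y => sq_nonneg _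
    have h1 : ∫ y in tet v, h ^ 2 * ‖pgrad p y‖ ^ 2 ≤
        C * (h ^ 3)⁻¹ * (∫ y in tet v, (pev p y) ^ 2) * (volume (tet v)).toReal := by
      have hb : ∀ y ∈ tet v, ‖h ^ 2 * ‖pgrad p y‖ ^ 2‖ ≤ C * (h ^ 3)⁻¹ * ∫ y in tet v, (pev p y) ^ 2 := by
        intro y hy
        rw [Real.norm_eq_abs, abs_of_nonneg (by positivity)]
        exact (hI y hy).2
      have := norm_setIntegral_le_of_norm_le_const (μ := volume) (isCompact_tet v).measure_lt_top hb
      exact (le_abs_self _).trans this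
    rw [integral_const_mul] at h1
    refine h1.trans ?_
    calc _ ≤ C * (h ^ 3)⁻¹ * (∫ y in tet v, (pev p y) ^ 2) * (B * h ^ 3) := by gcongr
      _ = _ := by field_simp

lemma cube_le {a b : ℝ} (ha : 0 ≤ a) (hb : 0 ≤ b) : (a + b) ^ 3 ≤ 4 * a ^ 3 + 4 * b ^ 3 := by
  nlinarith [mul_nonneg (add_nonneg ha hb) (sq_nonneg (a - b))]

set_option maxHeartbeats 1000000 in
lemma convert_int {x0 : E3} {s R h : ℝ} (hh : 0 < h) (hs : 2 * h ≤ s) (hsR : s ≤ R)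
    {v : Fin 4 → E3} (hd : Metric.diam (tet v) ≤ h) (htouch : ∃ y ∈ tet v, tt x0 s R y ≠ 0)
    {y0 : E3} (hy0 : y0 ∈ tet v) {P Q Θ : ℝ} (hP : P = (pp x0 s y0)⁻¹) (hQ : Q = R⁻¹)
    (hΘ : Θ = tt x0 s R y0 + 4 * (h * R⁻¹)) {f g : E3 → ℝ} (hf : Continuous f) (hg : Continuous g)
    (hf0 : ∀ y, 0 ≤ f y) (hg0 : ∀ y, 0 ≤ g y) {D : ℝ}
    (hfg : h ^ 2 * ∫ y in tet v, f y ≤ D * ∫ y in tet v, g y) (hD : 0 ≤ D) :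
    P * Θ ^ 3 * (∫ y in tet v, f y) + s ^ 2 * P ^ 5 * Θ ^ 3 * ∫ y in tet v, g y ≤
      128 * (∫ y in tet v, ((pp x0 s y)⁻¹ * tt x0 s R y ^ 3 * f y +
        s ^ 2 * (pp x0 s y)⁻¹ ^ 5 * tt x0 s R y ^ 3 * g y)) +
      2048 * (D + 1) * Q ^ 3 * ∫ y in tet v, g y := by
  have hs0 : 0 < s := by linarith
  have hR0 : 0 < R := by linarith
  obtain ⟨G1, G2, G3⟩ := geom hh hs hsR hd htouch
  have p0 := pp_pos (x0 := x0) hs0 y0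
  have hP0 : 0 < P := by rw [hP]; positivity
  have hQ0 : 0 < Q := by rw [hQ]; positivity
  have hsP : s * P ≤ 1 := by
    rw [hP, ← div_eq_mul_inv, div_le_one p0]; exact s_le_pp _ _ _
  have hhP : h * P ≤ 1 := by nlinarith
  have hΘ0 : 0 ≤ Θ := by
    rw [hΘ]; have := tt_nonneg x0 s R y0; positivity
  have hpt : ∀ y ∈ tet v, P * Θ ^ 3 * f y + s ^ 2 * P ^ 5 * Θ ^ 3 * g y ≤
      128 * ((pp x0 s y)⁻¹ * tt x0 s R y ^ 3 * f y +
        s ^ 2 * (pp x0 s y)⁻¹ ^ 5 * tt x0 s R y ^ 3 * g y) +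
      (2048 * (P * (h * Q) ^ 3) * f y + 2048 * (s ^ 2 * P ^ 5 * (h * Q) ^ 3) * g y) := by
    intro y hy
    have py := pp_pos (x0 := x0) hs0 y
    have t0 := tt_nonneg x0 s R y
    have hPy : P ≤ 2 * (pp x0 s y)⁻¹ := by
      have := G2 y hy y0 hy0
      rw [hP, inv_le_comm₀ p0 (by positivity), mul_inv, inv_inv]
      linarith
    have hΘy : Θ ≤ tt x0 s R y + 8 * (h * Q) := by
      have := G3 y0 hy0 y hy
      rw [hΘ, hQ]; linarith
    have h3 : Θ ^ 3 ≤ 4 * tt x0 s R y ^ 3 + 2048 * (h * Q) ^ 3 := by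
      refine (pow_le_pow_left₀ hΘ0 hΘy 3).trans ((cube_le t0 (by positivity)).trans (le_of_eq ?_))
      ring
    have a1 : P * Θ ^ 3 ≤ 8 * ((pp x0 s y)⁻¹ * tt x0 s R y ^ 3) + 2048 * (P * (h * Q) ^ 3) := by
      calc P * Θ ^ 3 ≤ P * (4 * tt x0 s R y ^ 3 + 2048 * (h * Q) ^ 3) := by gcongr
        _ = 4 * P * tt x0 s R y ^ 3 + 2048 * (P * (h * Q) ^ 3) := by ring
        _ ≤ 4 * (2 * (pp x0 s y)⁻¹) * tt x0 s R y ^ 3 + 2048 * (P * (h * Q) ^ 3) := by gcongr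
        _ = _ := by ring
    have a2 : P ^ 5 * Θ ^ 3 ≤ 128 * ((pp x0 s y)⁻¹ ^ 5 * tt x0 s R y ^ 3) + 2048 * (P ^ 5 * (h * Q) ^ 3) := by
      calc P ^ 5 * Θ ^ 3 ≤ P ^ 5 * (4 * tt x0 s R y ^ 3 + 2048 * (h * Q) ^ 3) := by gcongr
        _ = 4 * P ^ 5 * tt x0 s R y ^ 3 + 2048 * (P ^ 5 * (h * Q) ^ 3) := by ring
        _ ≤ 4 * (2 * (pp x0 s y)⁻¹) ^ 5 * tt x0 s R y ^ 3 + 2048 * (P ^ 5 * (h * Q) ^ 3) := by gcongr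
        _ = _ := by ring
    have b1 := mul_le_mul_of_nonneg_right a1 (hf0 y)
    have b2 := mul_le_mul_of_nonneg_left (mul_le_mul_of_nonneg_right a2 (hg0 y)) (sq_nonneg s)
    have b3 : 0 ≤ (pp x0 s y)⁻¹ * tt x0 s R y ^ 3 * f y := by have := hf0 y; positivity
    nlinarith
  have cpi := continuous_ppi x0 hs0
  have ct := continuous_tt x0 s R
  have I : ∀ {k : E3 → ℝ}, Continuous k → IntegrableOn k (tet v) := fun hk => io_tet hk v
  have cG : Continuous (fun y => ((pp x0 s y)⁻¹ * tt x0 s R y ^ 3 * f y +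
        s ^ 2 * (pp x0 s y)⁻¹ ^ 5 * tt x0 s R y ^ 3 * g y)) := by fun_prop
  have hint := setIntegral_mono_on (μ := volume) (I (by fun_prop)) (I (by fun_prop))
    (isCompact_tet v).measurableSet hpt
  have split2 : ∀ a b : ℝ, ∫ y in tet v, (a * f y + b * g y) =
      a * (∫ y in tet v, f y) + b * ∫ y in tet v, g y := by
    intro a b
    rw [integral_add (I (by fun_prop)) (I (by fun_prop)), integral_const_mul, integral_const_mul]
  have splitG : ∀ {G H : E3 → ℝ}, Continuous G → Continuous H → ∫ y in tet v, (128 * G y + H y) =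
      128 * (∫ y in tet v, G y) + ∫ y in tet v, H y := by
    intro G H hG hH
    rw [integral_add (I (by fun_prop)) (I (by fun_prop)), integral_const_mul]
  rw [split2, splitG cG (by fun_prop), split2] at hint
  have hY : 0 ≤ ∫ y in tet v, g y := integral_nonneg hg0
  have hX : 0 ≤ ∫ y in tet v, f y := integral_nonneg hf0
  have c1 : P * (h * Q) ^ 3 * (∫ y in tet v, f y) ≤ D * Q ^ 3 * ∫ y in tet v, g y := by
    calc P * (h * Q) ^ 3 * (∫ y in tet v, f y) = (h * P) * Q ^ 3 * (h ^ 2 * ∫ y in tet v, f y) := by ring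
      _ ≤ 1 * Q ^ 3 * (D * ∫ y in tet v, g y) := by gcongr
      _ = _ := by ring
  have c2 : s ^ 2 * P ^ 5 * (h * Q) ^ 3 * (∫ y in tet v, g y) ≤ Q ^ 3 * ∫ y in tet v, g y := by
    calc s ^ 2 * P ^ 5 * (h * Q) ^ 3 * (∫ y in tet v, g y)
        = (s * P) ^ 2 * (h * P) ^ 3 * (Q ^ 3 * ∫ y in tet v, g y) := by ring
      _ ≤ 1 ^ 2 * 1 ^ 3 * (Q ^ 3 * ∫ y in tet v, g y) := by gcongr
      _ = _ := by ring
  nlinarith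

end PB

namespace PB

set_option maxHeartbeats 1000000 in
lemma tet_est (r : ℕ) (hr : 1 ≤ r) {c : ℝ} (hc : 0 < c) {ε : ℝ} (hε : 0 < ε) :
    ∃ K0 C : ℝ, 2 ≤ K0 ∧ 0 < C ∧ ∀ K h R : ℝ, K0 ≤ K → 0 < h → K * h ≤ R → ∀ x0 : E3,
    ∀ (v : Fin 4 → E3) (hv : AffineIndependent ℝ v) (z : E3), Metric.diam (tet v) ≤ h →
    closedBall z (c * h) ⊆ tet v → (∃ y ∈ tet v, tt x0 (K * h) R y ≠ 0) →
    ∀ p : MvPolynomial (Fin 3) ℝ, p.totalDegree ≤ r →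
    ∀ q : MvPolynomial (Fin 3) ℝ, q.totalDegree ≤ r →
    (∀ x, pev q x = lag r (vs v) (fun y => pev p y * Phi x0 (K * h) R y) (bc v hv x)) →
    ∫ x in tet v, ‖pgrad p x‖ * ‖pgrad q x - (Phi x0 (K * h) R x • pgrad p x
        + pev p x • VV x0 (K * h) R x)‖ ≤
      ε * (∫ x in tet v, ((pp x0 (K * h) x)⁻¹ * tt x0 (K * h) R x ^ 3 * ‖pgrad p x‖ ^ 2 +
        (K * h) ^ 2 * (pp x0 (K * h) x)⁻¹ ^ 5 * tt x0 (K * h) R x ^ 3 * pev p x ^ 2)) +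
      C * R⁻¹ ^ 3 * ∫ x in tet v, pev p x ^ 2 := by
  obtain ⟨C1, hC1, H1⟩ := local_err r hr hc
  obtain ⟨C2, B, hC2, hB, H2⟩ := inv2 r hc
  set N := C1 * C2 * B with hN
  have hN0 : 0 < N := by positivity
  have hC0 : 0 < Real.sqrt (C2 * B) := Real.sqrt_pos.2 (by positivity)
  obtain ⟨K0, C, hK0, hC, H3⟩ := arith hC0 (show 0 < ε / (128 * N) by positivity)
  refine ⟨K0, ε * 16 * (C2 * B + 1) + N * C, hK0, by positivity, ?_⟩
  intro K h R hK hh hKR x0 v hv z hd hz htouch p hp q hq hqe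
  have hs2 : 2 * h ≤ K * h := by nlinarith
  have hs0 : 0 < K * h := by linarith
  have hR0 : 0 < R := by linarith
  have hy0 : z ∈ tet v := hz (mem_closedBall_self (by positivity))
  obtain ⟨hvol, Hp⟩ := H2 h hh v z hd hz
  obtain ⟨I1, I2, I3⟩ := Hp p hp
  obtain ⟨G1, G2, G3⟩ := geom hh hs2 hKR hd htouch
  obtain ⟨P, hP⟩ : ∃ P, P = (pp x0 (K * h) z)⁻¹ := ⟨_, rfl⟩
  obtain ⟨Q, hQ⟩ : ∃ Q, Q = R⁻¹ := ⟨_, rfl⟩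
  obtain ⟨Θ, hΘ⟩ : ∃ Θ, Θ = tt x0 (K * h) R z + 4 * (h * R⁻¹) := ⟨_, rfl⟩
  obtain ⟨D1b, D2b⟩ := DD_bounds hh hs2 hKR hd htouch hy0 hP hQ hΘ
  have cvt := convert_int hh hs2 hKR hd htouch hy0 hP hQ hΘ (f := fun y => ‖pgrad p y‖ ^ 2)
    (g := fun y => pev p y ^ 2) ((continuous_pgrad p).norm.pow 2) ((continuous_pev p).pow 2)
    (fun y => sq_nonneg _) (fun y => sq_nonneg _) I3 (by positivity)
  have p0 := pp_pos (x0 := x0) hs0 z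
  have hP0 : 0 < P := by rw [hP]; positivity
  have hQ0 : 0 < Q := by rw [hQ]; positivity
  have hX : 0 ≤ ∫ y in tet v, ‖pgrad p y‖ ^ 2 := integral_nonneg fun y => sq_nonneg _
  have hY : 0 ≤ ∫ y in tet v, pev p y ^ 2 := integral_nonneg fun y => sq_nonneg _
  generalize (∫ y in tet v, ‖pgrad p y‖ ^ 2) = X at *
  generalize (∫ y in tet v, pev p y ^ 2) = Y at *
  have hA2 := Real.sq_sqrt hX
  have hB2 := Real.sq_sqrt hY
  have hA0 := Real.sqrt_nonneg X
  have hB0 := Real.sqrt_nonneg Y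
  generalize Real.sqrt X = A at *
  generalize Real.sqrt Y = Y' at *
  have hhQ : h * Q ≤ 1 := by
    rw [hQ, ← div_eq_mul_inv, div_le_one hR0]; linarith
  have hΘ0 : 0 ≤ Θ := by
    rw [hΘ]; have := tt_nonneg x0 (K * h) R z; positivity
  have hΘ5 : Θ ≤ 5 := by
    have := tt_le_one x0 (K * h) R z
    rw [hΘ, ← hQ]; linarith
  have hQP : Q ≤ 2 * P := by
    have := G1 z hy0
    rw [hP, hQ, inv_le_comm₀ hR0 (by positivity), mul_inv, inv_inv]
    linarith
  have hPK : h * P * K ≤ 1 := by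
    have e : h * P * K = (K * h) / pp x0 (K * h) z := by rw [hP]; ring
    rw [e, div_le_one p0]; exact s_le_pp _ _ _
  have hAB : h * A ≤ Real.sqrt (C2 * B) * Y' := by
    apply le_of_sq_le_sq _ (by positivity)
    rw [mul_pow, mul_pow, Real.sq_sqrt (by positivity), hA2, hB2]
    exact I3
  have har := H3 K h R P Q Θ A Y' hK hh hPK hhQ hQP hP0 hQ0 hΘ0 hΘ5 hA0 hB0 hAB
  set D1 := 4 * P ^ 2 * Θ ^ 3 + 6 * Q ^ 2 * Θ ^ 2 with hD1
  set D2 := 32 * P ^ 3 * Θ ^ 3 + 36 * P * Q ^ 2 * Θ ^ 2 + 48 * Q ^ 3 * Θ with hD2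
  have hD10 : 0 ≤ D1 := by positivity
  have hD20 : 0 ≤ D2 := by positivity
  set m := Real.sqrt (C2 * (h ^ 3)⁻¹) with hm
  have hm2 : m ^ 2 = C2 * (h ^ 3)⁻¹ := Real.sq_sqrt (by positivity)
  have hm0 : 0 ≤ m := Real.sqrt_nonneg _
  have hM0 : ∀ y ∈ tet v, |pev p y| ≤ m * Y' := by
    intro y hy
    apply abs_le_of_sq_le_sq _ (by positivity)
    rw [mul_pow, hm2, hB2]; exact I1 y hy
  have hM1 : ∀ y ∈ tet v, ‖pgrad p y‖ ≤ m * A := by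
    intro y hy
    apply le_of_sq_le_sq _ (by positivity)
    rw [mul_pow, hm2, hA2]; exact I2 y hy
  have herr := H1 h hh v hv z hd hz p hp (Phi x0 (K * h) R) (VV x0 (K * h) R) D1 D2 (m * Y') (m * A)
    (fun y _ => hasGradientAt_Phi x0 R hs0 y) D1b D2b hM0 hM1 q hq hqe
  have hL : ∫ x in tet v, ‖pgrad p x‖ * ‖pgrad q x - (Phi x0 (K * h) R x • pgrad p x
        + pev p x • VV x0 (K * h) R x)‖ ≤
      (m * A * (C1 * h * (D2 * (m * Y') + D1 * (m * A)))) * (volume (tet v)).toReal := by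
    have hb : ∀ y ∈ tet v, ‖‖pgrad p y‖ * ‖pgrad q y - (Phi x0 (K * h) R y • pgrad p y
        + pev p y • VV x0 (K * h) R y)‖‖ ≤ m * A * (C1 * h * (D2 * (m * Y') + D1 * (m * A))) := by
      intro y hy
      rw [Real.norm_eq_abs, abs_of_nonneg (by positivity)]
      exact mul_le_mul (hM1 y hy) (herr y hy) (norm_nonneg _) (by positivity)
    exact (le_abs_self _).trans
      (norm_setIntegral_le_of_norm_le_const (μ := volume) (isCompact_tet v).measure_lt_top hb)
  refine hL.trans ?_
  have e1 : (m * A * (C1 * h * (D2 * (m * Y') + D1 * (m * A)))) * (volume (tet v)).toReal ≤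
      N * (h * D1 * A ^ 2 + h * D2 * (A * Y')) := by
    calc _ ≤ (m * A * (C1 * h * (D2 * (m * Y') + D1 * (m * A)))) * (B * h ^ 3) := by gcongr
      _ = m ^ 2 * h ^ 3 * C1 * B * (h * D1 * A ^ 2 + h * D2 * (A * Y')) := by ring
      _ = _ := by rw [hm2, hN]; field_simp
  refine e1.trans ?_
  have e2 := mul_le_mul_of_nonneg_left har hN0.le
  refine e2.trans ?_
  rw [hA2, hB2]
  have e3 := mul_le_mul_of_nonneg_left cvt (show 0 ≤ ε / 128 by positivity)
  have e4 : N * (ε / (128 * N) * (P * Θ ^ 3 * X + (K * h) ^ 2 * P ^ 5 * Θ ^ 3 * Y) + C * Q ^ 3 * Y) =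
      ε / 128 * (P * Θ ^ 3 * X + (K * h) ^ 2 * P ^ 5 * Θ ^ 3 * Y) + N * C * Q ^ 3 * Y := by
    field_simp
  rw [e4, ← hQ]
  refine (add_le_add_left e3 _).trans (le_of_eq ?_)
  ring

end PB

namespace PB

lemma pp_le_of_tt {x0 : E3} {s R : ℝ} (hs : 0 < s) (hR : 0 < R) {x : E3} (h : tt x0 s R x ≠ 0) :
    pp x0 s x ≤ R := by
  by_contra hcon
  push Not at hcon
  apply h
  rw [tt_eq]
  apply max_eq_left
  have : 1 ≤ pp x0 s x ^ 2 * (R ^ 2)⁻¹ := by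
    rw [← div_eq_mul_inv, one_le_div (by positivity)]
    gcongr
  linarith

lemma mem_of_tt {x0 : E3} {s R : ℝ} (hs : 0 < s) (hR : 0 < R) {x : E3} (h : tt x0 s R x ≠ 0) :
    ‖x - x0‖ ≤ R := (norm_le_pp _ _ _).trans (pp_le_of_tt hs hR h)

lemma pp_tt_le {x0 : E3} {s R : ℝ} (hs : 0 < s) (hR : 0 < R) (x : E3) : pp x0 s x * tt x0 s R x ≤ R := by
  by_cases h : tt x0 s R x = 0
  · rw [h]; simp [hR.le]
  · have := pp_le_of_tt hs hR h
    have h1 := tt_le_one x0 s R x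
    have h0 := pp_pos (x0 := x0) hs x
    nlinarith

lemma Phi_zero {x0 : E3} {s R : ℝ} {x : E3} (h : tt x0 s R x = 0) : Phi x0 s R x = 0 := by
  rw [Phi_eq, h]; simp

lemma VV_zero {x0 : E3} {s R : ℝ} (hs : 0 < s) {x : E3} (h : tt x0 s R x = 0) : VV x0 s R x = 0 := by
  have := norm_VV_le (R := R) (x0 := x0) hs x
  rw [h] at this
  simpa using this

lemma DV_zero {x0 : E3} {s R : ℝ} (hs : 0 < s) {x : E3} (h : tt x0 s R x = 0) : DV x0 s R x = 0 := by
  have := norm_DV_le (R := R) (x0 := x0) hs x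
  rw [h] at this
  simpa using this

lemma DV_bd {x0 : E3} {s R : ℝ} (hs : 0 < s) (hR : 0 < R) (x : E3) : ‖DV x0 s R x‖ ≤
    4 * s⁻¹ ^ 3 + 18 * (R ^ 2)⁻¹ * s⁻¹ + 24 * (R ^ 2)⁻¹ ^ 2 * R := by
  refine (norm_DV_le hs x).trans ?_
  have h0 := pp_pos (x0 := x0) hs x
  have h1 : (pp x0 s x)⁻¹ ≤ s⁻¹ := by gcongr; exact s_le_pp _ _ _
  have h2 := tt_nonneg x0 s R x
  have h3 := tt_le_one x0 s R x
  have h4 := pp_tt_le (x0 := x0) hs hR x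
  have h5 : tt x0 s R x ^ 3 ≤ 1 := pow_le_one₀ h2 h3
  have h6 : tt x0 s R x ^ 2 ≤ 1 := pow_le_one₀ h2 h3
  have a1 : 4 * (pp x0 s x)⁻¹ ^ 3 * tt x0 s R x ^ 3 ≤ 4 * s⁻¹ ^ 3 * 1 := by gcongr
  have a2 : 18 * (R ^ 2)⁻¹ * (pp x0 s x)⁻¹ * tt x0 s R x ^ 2 ≤ 18 * (R ^ 2)⁻¹ * s⁻¹ * 1 := by gcongr
  have a3 : 24 * (R ^ 2)⁻¹ ^ 2 * pp x0 s x * tt x0 s R x ≤ 24 * (R ^ 2)⁻¹ ^ 2 * R := by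
    rw [mul_assoc]; gcongr
  linarith

/-- Measurable and bounded on `Ω`. -/
def Gd {F : Type} [NormedAddCommGroup F] [MeasurableSpace F] (Ω : Set E3) (f : E3 → F) : Prop :=
  Measurable f ∧ ∃ M : ℝ, ∀ x ∈ Ω, ‖f x‖ ≤ M

lemma Gd.of_cont {F : Type} [NormedAddCommGroup F] [MeasurableSpace F] [BorelSpace F] {Ω : Set E3}
    (hΩ : Bornology.IsBounded Ω) {f : E3 → F} (hf : Continuous f) : Gd Ω f := by
  refine ⟨hf.measurable, ?_⟩
  obtain ⟨M, hM⟩ := hΩ.isCompact_closure.exists_bound_of_continuousOn hf.continuousOn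
  exact ⟨M, fun x hx => hM x (subset_closure hx)⟩

lemma Gd.norm {Ω : Set E3} {f : E3 → E3} (hf : Gd Ω f) : Gd Ω (fun x => ‖f x‖) := by
  obtain ⟨h, M, hM⟩ := hf
  exact ⟨h.norm, M, fun x hx => by simpa using hM x hx⟩

lemma Gd.addR {Ω : Set E3} {f g : E3 → ℝ} (hf : Gd Ω f) (hg : Gd Ω g) : Gd Ω (fun x => f x + g x) := by
  obtain ⟨h, M, hM⟩ := hf
  obtain ⟨h', M', hM'⟩ := hg
  exact ⟨h.add h', M + M', fun x hx => (norm_add_le _ _).trans (add_le_add (hM x hx) (hM' x hx))⟩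

lemma Gd.addE {Ω : Set E3} {f g : E3 → E3} (hf : Gd Ω f) (hg : Gd Ω g) : Gd Ω (fun x => f x + g x) := by
  obtain ⟨h, M, hM⟩ := hf
  obtain ⟨h', M', hM'⟩ := hg
  exact ⟨h.add h', M + M', fun x hx => (norm_add_le _ _).trans (add_le_add (hM x hx) (hM' x hx))⟩

lemma Gd.subE {Ω : Set E3} {f g : E3 → E3} (hf : Gd Ω f) (hg : Gd Ω g) : Gd Ω (fun x => f x - g x) := by
  obtain ⟨h, M, hM⟩ := hf
  obtain ⟨h', M', hM'⟩ := hg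
  exact ⟨h.sub h', M + M', fun x hx => (norm_sub_le _ _).trans (add_le_add (hM x hx) (hM' x hx))⟩

lemma Gd.mul {Ω : Set E3} {f g : E3 → ℝ} (hf : Gd Ω f) (hg : Gd Ω g) : Gd Ω (fun x => f x * g x) := by
  obtain ⟨h, M, hM⟩ := hf
  obtain ⟨h', M', hM'⟩ := hg
  refine ⟨h.mul h', M * M', fun x hx => ?_⟩
  rw [norm_mul]
  exact mul_le_mul (hM x hx) (hM' x hx) (norm_nonneg _) ((norm_nonneg _).trans (hM x hx))

lemma Gd.smul {Ω : Set E3} {f : E3 → ℝ} {g : E3 → E3} (hf : Gd Ω f) (hg : Gd Ω g) :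
    Gd Ω (fun x => f x • g x) := by
  obtain ⟨h, M, hM⟩ := hf
  obtain ⟨h', M', hM'⟩ := hg
  refine ⟨h.smul h', M * M', fun x hx => ?_⟩
  rw [norm_smul]
  exact mul_le_mul (hM x hx) (hM' x hx) (norm_nonneg _) ((norm_nonneg _).trans (hM x hx))

lemma Gd.inner {Ω : Set E3} {f g : E3 → E3} (hf : Gd Ω f) (hg : Gd Ω g) :
    Gd Ω (fun x => ⟪f x, g x⟫) := by
  obtain ⟨h, M, hM⟩ := hf
  obtain ⟨h', M', hM'⟩ := hg
  refine ⟨h.inner h', M * M', fun x hx => ?_⟩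
  exact (norm_inner_le_norm _ _).trans
    (mul_le_mul (hM x hx) (hM' x hx) (norm_nonneg _) ((norm_nonneg _).trans (hM x hx)))

lemma Gd.ind {Ω : Set E3} {f : E3 → ℝ} (hf : Gd Ω f) {S : Set E3} (hS : MeasurableSet S) :
    Gd Ω (S.indicator f) := by
  obtain ⟨h, M, hM⟩ := hf
  exact ⟨h.indicator hS, M, fun x hx => (norm_indicator_le_norm_self f x).trans (hM x hx)⟩

lemma Gd.io {Ω : Set E3} (hΩ : IsOpen Ω) (hb : Bornology.IsBounded Ω) {f : E3 → ℝ} (hf : Gd Ω f) :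
    IntegrableOn f Ω := by
  obtain ⟨h, M, hM⟩ := hf
  apply IntegrableOn.of_bound hb.measure_lt_top h.aestronglyMeasurable M
  filter_upwards [ae_restrict_mem hΩ.measurableSet] with x hx
  exact hM x hx

end PB

namespace PB

lemma step1 {Ω : Set E3} (hΩ : IsOpen Ω) (hb : Bornology.IsBounded Ω) {u : E3 → ℝ} {L : ℝ≥0}
    (hu : LipschitzWith L u) {x0 : E3} {s R d : ℝ} (hs : 0 < s) (hR : 0 < R) (hRd : R < d)
    (hball : ball x0 d ⊆ Ω) :
    3 * (∫ x in Ω, s ^ 2 * (pp x0 s x)⁻¹ ^ 5 * tt x0 s R x ^ 3 * u x ^ 2) -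
      24 * R⁻¹ ^ 3 * (∫ x in Ω ∩ ball x0 d, u x ^ 2) ≤
    2 * ∫ x in Ω, u x * ⟪gradient u x, VV x0 s R x⟫ := by
  have hz : ∀ x, x ∉ ball x0 d → tt x0 s R x = 0 := by
    intro x hx
    by_contra h
    apply hx
    rw [mem_ball, dist_eq_norm]
    exact (mem_of_tt hs hR h).trans_lt hRd
  have hz' : ∀ x, x ∉ closedBall x0 R → tt x0 s R x = 0 := by
    intro x hx
    by_contra h
    apply hx
    rw [mem_closedBall, dist_eq_norm]
    exact mem_of_tt hs hR h
  obtain ⟨I1, I2, e⟩ := ibp hu (hasFDerivAt_VV x0 R hs) (DV_bd hs hR) (x0 := x0) (ρ := R)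
    (fun x hx => VV_zero hs (hz' x hx))
  have q1 : ∫ x in Ω, u x * ⟪gradient u x, VV x0 s R x⟫ = ∫ x, u x * ⟪gradient u x, VV x0 s R x⟫ :=
    setIntegral_eq_integral_of_forall_compl_eq_zero (fun x hx => by
      rw [VV_zero hs (hz x (fun h => hx (hball h)))]; simp)
  have q2 : ∫ x in Ω, u x ^ 2 * ∑ i : Fin 3, DV x0 s R x (EuclideanSpace.single i 1) i =
      ∫ x, u x ^ 2 * ∑ i : Fin 3, DV x0 s R x (EuclideanSpace.single i 1) i :=
    setIntegral_eq_integral_of_forall_compl_eq_zero (fun x hx => by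
      rw [DV_zero hs (hz x (fun h => hx (hball h)))]; simp)
  rw [q1, e, ← q2, ← setIntegral_indicator measurableSet_ball,
    ← integral_const_mul, ← integral_const_mul, ← integral_neg]
  have cpi := continuous_ppi x0 hs
  have ct := continuous_tt x0 s R
  have cu := hu.continuous
  have J1 : IntegrableOn (fun x => 3 * (s ^ 2 * (pp x0 s x)⁻¹ ^ 5 * tt x0 s R x ^ 3 * u x ^ 2)) Ω :=
    (Gd.of_cont hb (by fun_prop)).io hΩ hb
  have J2 : IntegrableOn (fun x => 24 * R⁻¹ ^ 3 * (ball x0 d).indicator (fun x => u x ^ 2) x) Ω :=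
    (((Gd.of_cont hb (show Continuous fun x => u x ^ 2 by fun_prop)).ind measurableSet_ball).io hΩ hb).const_mul _
  rw [← integral_sub J1 J2]
  refine setIntegral_mono_on (J1.sub J2) I2.neg.integrableOn hΩ.measurableSet fun x _ => ?_
  simp only [Pi.neg_apply]
  rw [trace_DV]
  have hl := lap_le (x0 := x0) (R := R) hs x
  by_cases hx : x ∈ ball x0 d
  · rw [indicator_of_mem hx]
    have h4 := pp_tt_le (x0 := x0) hs hR x
    have h5 : 24 * (R ^ 2)⁻¹ ^ 2 * pp x0 s x * tt x0 s R x ≤ 24 * R⁻¹ ^ 3 := by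
      calc _ = 24 * (R ^ 2)⁻¹ ^ 2 * (pp x0 s x * tt x0 s R x) := by ring
        _ ≤ 24 * (R ^ 2)⁻¹ ^ 2 * R := by gcongr
        _ = _ := by field_simp
    have := mul_le_mul_of_nonneg_left (hl.trans (add_le_add_right h5 _)) (sq_nonneg (u x))
    linarith
  · rw [indicator_of_notMem hx]
    have := mul_le_mul_of_nonneg_left hl (sq_nonneg (u x))
    rw [hz x hx] at this ⊢
    simp at this ⊢
    linarith

lemma int_ae (v : Fin 4 → E3) : interior (tet v) =ᵐ[volume] tet v :=
  interior_ae_eq_of_null_frontier ((convex_tet v).addHaar_frontier volume)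

set_option maxHeartbeats 2000000 in
lemma energy (r : ℕ) (hr : 1 ≤ r) {c : ℝ} (hc : 0 < c) :
    ∃ K C : ℝ, 2 ≤ K ∧ 0 < C ∧ ∀ (Ω : Set E3), IsOpen Ω → Bornology.IsBounded Ω → Convex ℝ Ω →
    ∀ h : ℝ, 0 < h → ∀ T : Finset (Fin 4 → E3), IsTetPartition Ω T h c →
    Set.InjOn tet (T : Set (Fin 4 → E3)) →
    ∀ (u : E3 → ℝ) (L : ℝ≥0), LipschitzWith L u → MemSh Ω T r u →
    (∀ χ : E3 → ℝ, MemSh0 Ω T r χ → ∫ x in Ω, ⟪gradient u x, gradient χ x⟫ = 0) →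
    ∀ (x0 : E3) (R d : ℝ), K * h ≤ R → R + h < d → ball x0 d ⊆ Ω →
    ∫ x in Ω, (K * h) ^ 2 * (pp x0 (K * h) x)⁻¹ ^ 5 * tt x0 (K * h) R x ^ 3 * u x ^ 2 ≤
      C * R⁻¹ ^ 3 * ∫ x in Ω ∩ ball x0 d, u x ^ 2 := by
  obtain ⟨K, C, hK, hC, HT⟩ := tet_est r hr hc (show (0 : ℝ) < 1 / 2 by norm_num)
  refine ⟨K, 12 + C, hK, by positivity, ?_⟩
  intro Ω hΩ hb hconv h hh T hT hinj u L hLu hu hharm x0 R d hKR hRd hball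
  have hTc := hT
  obtain ⟨haff, hun, -, -, hdiam, hcb⟩ := hT
  have HT' := fun v hv z => HT K h R le_rfl hh hKR x0 v hv z
  have hs0 : 0 < K * h := by positivity
  generalize K * h = s at *
  have hR0 : 0 < R := by linarith
  have S1 := step1 hΩ hb hLu hs0 hR0 (by linarith) hball
  -- touching tets lie in the ball
  have htb : ∀ v ∈ T, (∃ y ∈ tet v, tt x0 s R y ≠ 0) → ∀ x ∈ tet v, x ∈ ball x0 d := by
    rintro v hv ⟨y, hy, hty⟩ x hx
    rw [mem_ball, dist_eq_norm]
    have h1 := mem_of_tt hs0 hR0 hty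
    have h2 := tet_dist (hdiam v hv) hx hy
    calc ‖x - x0‖ = ‖(x - y) + (y - x0)‖ := by congr 1; abel
      _ ≤ ‖x - y‖ + ‖y - x0‖ := norm_add_le _ _
      _ < d := by linarith
  obtain ⟨χ, hχ, hχe⟩ := interp_exists hTc hinj r (fun y => u y * Phi x0 s R y)
  have hχ0 : ∀ v ∈ T, (¬ ∃ y ∈ tet v, tt x0 s R y ≠ 0) → ∀ x ∈ tet v, χ x = 0 := by
    intro v hv hnt x hx
    push Not at hnt
    rw [hχe v hv (haff v hv) x hx, lag_congr_w hr (w' := fun _ => 0)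
      (fun y hy => by rw [Phi_zero (hnt y hy), mul_zero])]
    simp [lag]
  have hχm : MemSh0 Ω T r χ := by
    refine ⟨hχ, fun x hx => ?_⟩
    have hx' : x ∈ ⋃ v ∈ T, tet v := by rw [hun]; exact frontier_subset_closure hx
    simp only [mem_iUnion, exists_prop] at hx'
    obtain ⟨v, hv, hxv⟩ := hx'
    apply hχ0 v hv _ x hxv
    intro ht
    have := hball (htb v hv ht x hxv)
    rw [hΩ.frontier_eq] at hx
    exact hx.2 this
  have h0 := hharm χ hχm
  obtain ⟨L', X, hX, hXe⟩ := exists_lip hconv hun hχ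
  -- goodness
  have cpi := continuous_ppi x0 hs0
  have ct := continuous_tt x0 s R
  have cu := hLu.continuous
  have gU : Gd Ω (gradient u) := ⟨measurable_gradient u, L, fun x _ => norm_gradient_le hLu x⟩
  have gX : Gd Ω (gradient χ) := by
    refine ⟨measurable_gradient χ, L', fun x hx => ?_⟩
    rw [grad_open hΩ (hXe.mono subset_closure) hx]
    exact norm_gradient_le hX x
  have gu : Gd Ω u := Gd.of_cont hb cu
  have gP : Gd Ω (Phi x0 s R) := Gd.of_cont hb (continuous_Phi x0 R hs0)
  have gV : Gd Ω (VV x0 s R) := Gd.of_cont hb (continuous_VV x0 R hs0)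
  have gXi : Gd Ω (fun x => ‖gradient u x‖ * ‖gradient χ x - (Phi x0 s R x • gradient u x
      + u x • VV x0 s R x)‖) := gU.norm.mul (gX.subE ((gP.smul gU).addE (gu.smul gV))).norm
  have g1 : Gd Ω (fun x => (pp x0 s x)⁻¹ * tt x0 s R x ^ 3 * (‖gradient u x‖ * ‖gradient u x‖)) :=
    (Gd.of_cont hb (by fun_prop)).mul (gU.norm.mul gU.norm)
  have g2 : Gd Ω (fun x => s ^ 2 * (pp x0 s x)⁻¹ ^ 5 * tt x0 s R x ^ 3 * u x ^ 2) :=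
    Gd.of_cont hb (by fun_prop)
  have g3 : Gd Ω ((ball x0 d).indicator (fun x => u x ^ 2)) :=
    (Gd.of_cont hb (show Continuous fun x => u x ^ 2 by fun_prop)).ind measurableSet_ball
  have g4 : Gd Ω (fun x => u x * ⟪gradient u x, VV x0 s R x⟫) := gu.mul (gU.inner gV)
  have g5 : Gd Ω (fun x => ⟪gradient u x, gradient χ x⟫) := gU.inner gX
  have i1 := g1.io hΩ hb
  have i2 := g2.io hΩ hb
  have i3 := g3.io hΩ hb
  have i4 := g4.io hΩ hb
  have i5 := g5.io hΩ hb
  have iXi := gXi.io hΩ hb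
  -- step 2
  have S2 : (∫ x in Ω, (pp x0 s x)⁻¹ * tt x0 s R x ^ 3 * (‖gradient u x‖ * ‖gradient u x‖)) +
      ∫ x in Ω, u x * ⟪gradient u x, VV x0 s R x⟫ ≤
      ∫ x in Ω, ‖gradient u x‖ * ‖gradient χ x - (Phi x0 s R x • gradient u x
      + u x • VV x0 s R x)‖ := by
    rw [← integral_add i1 i4]
    have : ∫ x in Ω, ‖gradient u x‖ * ‖gradient χ x - (Phi x0 s R x • gradient u x
      + u x • VV x0 s R x)‖ = ∫ x in Ω, (⟪gradient u x, gradient χ x⟫ +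
        ‖gradient u x‖ * ‖gradient χ x - (Phi x0 s R x • gradient u x
      + u x • VV x0 s R x)‖) := by
      rw [integral_add i5 iXi, h0, zero_add]
    rw [this]
    refine setIntegral_mono_on (i1.add i4) (i5.add iXi) hΩ.measurableSet fun x _ => ?_
    have hcs := abs_real_inner_le_norm (gradient u x) (gradient χ x - (Phi x0 s R x • gradient u x
      + u x • VV x0 s R x))
    have := (abs_le.1 hcs).1
    rw [inner_sub_right, inner_add_right, inner_smul_right, inner_smul_right,
      real_inner_self_eq_norm_mul_norm, Phi_eq] at this
    rw [Phi_eq]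
    simp only [Phi_eq] at *
    linarith
  -- step 3
  have S3 : ∫ x in Ω, ‖gradient u x‖ * ‖gradient χ x - (Phi x0 s R x • gradient u x
      + u x • VV x0 s R x)‖ ≤
      1 / 2 * (∫ x in Ω, ((pp x0 s x)⁻¹ * tt x0 s R x ^ 3 * (‖gradient u x‖ * ‖gradient u x‖) +
        s ^ 2 * (pp x0 s x)⁻¹ ^ 5 * tt x0 s R x ^ 3 * u x ^ 2)) +
      C * R⁻¹ ^ 3 * ∫ x in Ω, (ball x0 d).indicator (fun x => u x ^ 2) x := by
    rw [integral_part hconv hTc hinj iXi, integral_part hconv hTc hinj ((g1.addR g2).io hΩ hb),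
      integral_part hconv hTc hinj i3, Finset.mul_sum, Finset.mul_sum, ← Finset.sum_add_distrib]
    refine Finset.sum_le_sum fun v hv => ?_
    by_cases ht : ∃ y ∈ tet v, tt x0 s R y ≠ 0
    · obtain ⟨z, hz⟩ := hcb v hv
      obtain ⟨p, hp, hpe⟩ := hu.2 v hv
      have hpe' : ∀ x ∈ tet v, u x = pev p x := hpe
      obtain ⟨q, hq, hqe⟩ := lag_poly r (haff v hv) (fun y => pev p y * Phi x0 s R y)
      have hχq : ∀ x ∈ tet v, χ x = pev q x := by
        intro x hx
        rw [hqe, hχe v hv (haff v hv) x hx]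
        exact lag_congr_w hr fun y hy => by rw [hpe' y hy]
      have key := HT' v (haff v hv) z (hdiam v hv) hz ht p hp q hq hqe
      have m := (isOpen_interior (s := tet v)).measurableSet
      rw [← setIntegral_congr_set (int_ae v), ← setIntegral_congr_set (int_ae v),
        ← setIntegral_congr_set (int_ae v)] at key
      have e1 : ∫ x in interior (tet v), ‖gradient u x‖ * ‖gradient χ x -
          (Phi x0 s R x • gradient u x + u x • VV x0 s R x)‖ =
          ∫ x in interior (tet v), ‖pgrad p x‖ * ‖pgrad q x -
          (Phi x0 s R x • pgrad p x + pev p x • VV x0 s R x)‖ :=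
        setIntegral_congr_fun m fun x hx => by
          simp only [grad_interior hpe' hx, grad_interior hχq hx, hpe' x (interior_subset hx)]
      have e2 : ∫ x in interior (tet v), ((pp x0 s x)⁻¹ * tt x0 s R x ^ 3 * (‖gradient u x‖ * ‖gradient u x‖) +
        s ^ 2 * (pp x0 s x)⁻¹ ^ 5 * tt x0 s R x ^ 3 * u x ^ 2) =
          ∫ x in interior (tet v), ((pp x0 s x)⁻¹ * tt x0 s R x ^ 3 * ‖pgrad p x‖ ^ 2 +
        s ^ 2 * (pp x0 s x)⁻¹ ^ 5 * tt x0 s R x ^ 3 * pev p x ^ 2) :=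
        setIntegral_congr_fun m fun x hx => by
          simp only [grad_interior hpe' hx, hpe' x (interior_subset hx), sq]
      have e3 : ∫ x in interior (tet v), (ball x0 d).indicator (fun x => u x ^ 2) x =
          ∫ x in interior (tet v), pev p x ^ 2 :=
        setIntegral_congr_fun m fun x hx => by
          simp only [indicator_of_mem (htb v hv ht x (interior_subset hx)), hpe' x (interior_subset hx)]
      rw [e1, e2, e3]
      exact key
    · have hχz := hχ0 v hv ht
      have ht' := ht
      push Not at ht'
      have e1 : ∫ x in interior (tet v), ‖gradient u x‖ * ‖gradient χ x -
          (Phi x0 s R x • gradient u x + u x • VV x0 s R x)‖ = 0 := by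
        apply setIntegral_eq_zero_of_forall_eq_zero
        intro x hx
        have hx' := ht' x (interior_subset hx)
        have hg : gradient χ x = pgrad 0 x := grad_interior (fun y hy => by
          rw [hχz y hy]; simp [pev]) hx
        have : pgrad 0 x = 0 := by ext i; simp [pgrad, pev]
        rw [hg, this, Phi_zero hx', VV_zero hs0 hx']
        simp
      rw [e1]
      have n1 : 0 ≤ ∫ x in interior (tet v), ((pp x0 s x)⁻¹ * tt x0 s R x ^ 3 * (‖gradient u x‖ * ‖gradient u x‖) +
        s ^ 2 * (pp x0 s x)⁻¹ ^ 5 * tt x0 s R x ^ 3 * u x ^ 2) := by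
        apply integral_nonneg
        intro x
        have := pp_pos (x0 := x0) hs0 x
        have := tt_nonneg x0 s R x
        simp only [Pi.zero_apply]
        positivity
      have n2 : 0 ≤ ∫ x in interior (tet v), (ball x0 d).indicator (fun x => u x ^ 2) x := by
        apply integral_nonneg
        intro x
        exact indicator_nonneg (fun x _ => sq_nonneg _) x
      have n3 : 0 ≤ R⁻¹ := by positivity
      positivity
  rw [integral_add i1 i2, setIntegral_indicator measurableSet_ball] at S3
  have hW1 : 0 ≤ ∫ x in Ω, (pp x0 s x)⁻¹ * tt x0 s R x ^ 3 * (‖gradient u x‖ * ‖gradient u x‖) := by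
    apply integral_nonneg
    intro x
    have := pp_pos (x0 := x0) hs0 x
    have := tt_nonneg x0 s R x
    simp only [Pi.zero_apply]
    positivity
  linarith

end PB

namespace PB

lemma part_dedupe {Ω : Set E3} {T T' : Finset (Fin 4 → E3)} {h c : ℝ} (hT : IsTetPartition Ω T h c)
    (hsub : T' ⊆ T) (hall : ∀ v ∈ T, ∃ v' ∈ T', tet v' = tet v) : IsTetPartition Ω T' h c := by
  obtain ⟨h1, h2, h3, h4, h5, h6⟩ := hT
  refine ⟨fun v hv => h1 v (hsub hv), ?_, fun v hv w hw => h3 v (hsub hv) w (hsub hw),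
    fun v hv w hw => h4 v (hsub hv) w (hsub hw), fun v hv => h5 v (hsub hv), fun v hv => h6 v (hsub hv)⟩
  rw [← h2]
  apply Subset.antisymm
  · exact biUnion_subset_biUnion_left hsub
  · intro x hx
    simp only [mem_iUnion, exists_prop] at hx ⊢
    obtain ⟨v, hv, hxv⟩ := hx
    obtain ⟨v', hv', e⟩ := hall v hv
    exact ⟨v', hv', by rw [e]; exact hxv⟩

lemma int_sub {Ω : Set E3} {T : Finset (Fin 4 → E3)} (hΩ : IsOpen Ω) (hconv : Convex ℝ Ω)
    (hne : Ω.Nonempty) (hun : (⋃ v ∈ T, tet v) = closure Ω) {v : Fin 4 → E3} (hv : v ∈ T) :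
    interior (tet v) ⊆ Ω := by
  have : interior (tet v) ⊆ interior (closure Ω) := by
    apply interior_mono
    rw [← hun]
    exact subset_biUnion_of_mem (u := tet) hv
  rwa [hconv.interior_closure_eq_interior_of_nonempty_interior (by rwa [hΩ.interior_eq]),
    hΩ.interior_eq] at this

lemma ball_sub {Ω : Set E3} {x0 : E3} (hx : x0 ∈ closure Ω) (hΩ : IsOpen Ω)
    (hd : 0 < infDist x0 (frontier Ω)) : ball x0 (infDist x0 (frontier Ω)) ⊆ Ω := by
  have hx0 : x0 ∈ Ω := by
    by_contra h
    have : x0 ∈ frontier Ω := by rw [hΩ.frontier_eq]; exact ⟨hx, h⟩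
    rw [infDist_zero_of_mem this] at hd
    exact lt_irrefl _ hd
  intro y hy
  by_contra h
  have hpre : IsPreconnected (ball x0 (infDist x0 (frontier Ω))) :=
    (convex_ball _ _).isPreconnected
  obtain ⟨w, hw1, hw2⟩ : ∃ w, w ∈ ball x0 (infDist x0 (frontier Ω)) ∧ w ∈ frontier Ω := by
    by_contra hcon
    push Not at hcon
    have hcov : ball x0 (infDist x0 (frontier Ω)) ⊆ Ω ∪ (closure Ω)ᶜ := by
      intro w hw
      by_cases hwΩ : w ∈ Ω
      · exact Or.inl hwΩ
      · refine Or.inr fun hwc => hcon w hw ?_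
        rw [hΩ.frontier_eq]; exact ⟨hwc, hwΩ⟩
    obtain ⟨w, -, hw1, hw2⟩ := hpre Ω (closure Ω)ᶜ hΩ isClosed_closure.isOpen_compl hcov
      ⟨x0, mem_ball_self hd, hx0⟩ ⟨y, hy, (hcov hy).resolve_left h⟩
    exact hw2 (subset_closure hw1)
  have := infDist_le_dist_of_mem (x := x0) hw2
  rw [mem_ball, dist_comm] at hw1
  linarith

lemma weight_lb {x0 x : E3} {s R : ℝ} (hs : 0 < s) (hsR : 2 * s ≤ R) (hx : ‖x - x0‖ ≤ s) :
    1 ≤ 256 * s ^ 3 * (s ^ 2 * (pp x0 s x)⁻¹ ^ 5 * tt x0 s R x ^ 3) := by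
  have hR : 0 < R := by linarith
  have h0 := pp_pos (x0 := x0) hs x
  have hsq : pp x0 s x ^ 2 ≤ 2 * s ^ 2 := by
    rw [pp_sq]
    have := pow_le_pow_left₀ (norm_nonneg _) hx 2
    linarith
  have h1 : pp x0 s x ≤ 2 * s := by
    apply le_of_sq_le_sq _ (by positivity)
    nlinarith
  have h2 : 1 / 2 ≤ tt x0 s R x := by
    rw [tt_eq]
    apply le_max_of_le_right
    have : pp x0 s x ^ 2 * (R ^ 2)⁻¹ ≤ 1 / 2 := by
      rw [← div_eq_mul_inv, div_le_iff₀ (by positivity)]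
      nlinarith
    linarith
  have h3 : (2 * s)⁻¹ ≤ (pp x0 s x)⁻¹ := by gcongr
  calc (1 : ℝ) = 256 * s ^ 3 * (s ^ 2 * (2 * s)⁻¹ ^ 5 * (1 / 2) ^ 3) := by field_simp; norm_num
    _ ≤ _ := by gcongr

set_option maxHeartbeats 1000000 in
lemma main_sq (r : ℕ) (hr : 1 ≤ r) {c : ℝ} (hc : 0 < c) :
    ∃ C : ℝ, 0 < C ∧ ∀ (Ω : Set E3), IsOpen Ω → Bornology.IsBounded Ω → Convex ℝ Ω →
    ∀ h : ℝ, 0 < h → ∀ T : Finset (Fin 4 → E3), IsTetPartition Ω T h c →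
    ∀ (u : E3 → ℝ), MemSh Ω T r u →
    (∀ χ : E3 → ℝ, MemSh0 Ω T r χ → ∫ x in Ω, ⟪gradient u x, gradient χ x⟫ = 0) →
    ∀ x0 ∈ closure Ω, u x0 ^ 2 ≤ C * ((infDist x0 (frontier Ω) + 2 * h) ^ 3)⁻¹ *
      ∫ x in Ω ∩ ball x0 (infDist x0 (frontier Ω) + 2 * h), u x ^ 2 := by
  obtain ⟨K, C3, hK, hC3, HE⟩ := energy r hr hc
  obtain ⟨C2, B, hC2, -, HI⟩ := inv2 r hc
  refine ⟨C2 * (4 * K + 2) ^ 3 + C2 * 256 * K ^ 3 * C3 * 64, by positivity, ?_⟩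
  intro Ω hΩ hb hconv h hh T₀ hT₀ u₀ hu₀ hharm₀ x0 hx0
  have hne : Ω.Nonempty := closure_nonempty_iff.1 ⟨x0, hx0⟩
  obtain ⟨T, hsub, hinj, hall⟩ := dedupe T₀
  have hT := part_dedupe hT₀ hsub hall
  have hTc := hT
  obtain ⟨haff, hun, -, -, hdiam, hcb⟩ := hT
  have hu₁ : MemSh Ω T r u₀ := ⟨hu₀.1, fun v hv => hu₀.2 v (hsub hv)⟩
  obtain ⟨L, u, hL, hue⟩ := exists_lip hconv hun hu₁
  have htc : ∀ v ∈ T, tet v ⊆ closure Ω := fun v hv => by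
    rw [← hun]; exact subset_biUnion_of_mem (u := tet) hv
  have hu : MemSh Ω T r u := ⟨hL.continuous.continuousOn, fun v hv => by
    obtain ⟨p, hp, hpe⟩ := hu₁.2 v hv
    exact ⟨p, hp, fun x hx => by rw [← hue (htc v hv hx), hpe x hx]⟩⟩
  have hharm : ∀ χ : E3 → ℝ, MemSh0 Ω T r χ → ∫ x in Ω, ⟪gradient u x, gradient χ x⟫ = 0 := by
    intro χ hχ
    rw [← hharm₀ χ ⟨⟨hχ.1.1, fun v hv => ?_⟩, hχ.2⟩]
    · exact setIntegral_congr_fun hΩ.measurableSet fun x hx => by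
        simp only [grad_open hΩ (hue.mono subset_closure) hx]
    · obtain ⟨v', hv', e⟩ := hall v hv
      rw [← e]; exact hχ.1.2 v' hv'
  have eint : ∫ x in Ω ∩ ball x0 (infDist x0 (frontier Ω) + 2 * h), u₀ x ^ 2 =
      ∫ x in Ω ∩ ball x0 (infDist x0 (frontier Ω) + 2 * h), u x ^ 2 :=
    setIntegral_congr_fun (hΩ.inter isOpen_ball).measurableSet fun x hx => by
      simp only [hue (subset_closure hx.1)]
  rw [eint, hue hx0]
  have hx0' : x0 ∈ ⋃ v ∈ T, tet v := by rw [hun]; exact hx0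
  simp only [mem_iUnion, exists_prop] at hx0'
  obtain ⟨v, hv, hxv⟩ := hx0'
  obtain ⟨z, hz⟩ := hcb v hv
  obtain ⟨p, hp, hpe⟩ := hu.2 v hv
  have hpe' : ∀ x ∈ tet v, u x = pev p x := hpe
  have I1 := ((HI h hh v z (hdiam v hv) hz).2 p hp).1 x0 hxv
  have m := (isOpen_interior (s := tet v)).measurableSet
  have e1 : ∫ y in tet v, pev p y ^ 2 = ∫ y in interior (tet v), u y ^ 2 := by
    rw [← setIntegral_congr_set (int_ae v)]
    exact setIntegral_congr_fun m fun x hx => by simp only [hpe' x (interior_subset hx)]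
  rw [e1, ← hpe' x0 hxv] at I1
  have hiΩ := int_sub hΩ hconv hne hun hv
  have cu := hL.continuous
  have iu : IntegrableOn (fun x => u x ^ 2) Ω := (Gd.of_cont hb (by fun_prop)).io hΩ hb
  have d0 : 0 ≤ infDist x0 (frontier Ω) := infDist_nonneg
  have hbs := ball_sub hx0 hΩ
  obtain ⟨d, hd⟩ : ∃ d, d = infDist x0 (frontier Ω) := ⟨_, rfl⟩
  rw [← hd] at d0 hbs ⊢
  have hdist : ∀ x ∈ interior (tet v), ‖x - x0‖ ≤ h := fun x hx =>
    tet_dist (hdiam v hv) (interior_subset hx) hxv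
  set Y := ∫ x in Ω ∩ ball x0 (d + 2 * h), u x ^ 2 with hYdef
  have hY : 0 ≤ Y := integral_nonneg fun x => sq_nonneg _
  have hρ : 0 < d + 2 * h := by positivity
  rcases lt_or_ge d (4 * K * h) with hlt | hge
  · have hle : ∫ y in interior (tet v), u y ^ 2 ≤ Y := by
      apply setIntegral_mono_set (iu.mono_set inter_subset_left)
        (Filter.Eventually.of_forall fun x => sq_nonneg _)
      apply LE.le.eventuallyLE
      intro x hx
      refine ⟨hiΩ hx, ?_⟩
      rw [mem_ball, dist_eq_norm]
      have := hdist x hx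
      linarith
    have hh3 : (h ^ 3)⁻¹ ≤ (4 * K + 2) ^ 3 * ((d + 2 * h) ^ 3)⁻¹ := by
      rw [← div_eq_mul_inv, ← div_pow, ← inv_pow]
      gcongr
      rw [inv_eq_one_div, div_le_div_iff₀ hh hρ]
      linarith
    calc u x0 ^ 2 ≤ C2 * (h ^ 3)⁻¹ * ∫ y in interior (tet v), u y ^ 2 := I1
      _ ≤ C2 * ((4 * K + 2) ^ 3 * ((d + 2 * h) ^ 3)⁻¹) * Y := by gcongr
      _ = C2 * (4 * K + 2) ^ 3 * ((d + 2 * h) ^ 3)⁻¹ * Y := by ring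
      _ ≤ _ := by
        gcongr
        have : 0 ≤ C2 * 256 * K ^ 3 * C3 * 64 := by positivity
        linarith
  · have hKh : 2 * h ≤ K * h := by gcongr
    have hdp : 0 < d := by nlinarith
    have hball := hbs hdp
    have E := HE Ω hΩ hb hconv h hh T hTc hinj u L hL hu hharm x0 (d / 2) d (by linarith)
      (by linarith) hball
    have hs0 : 0 < K * h := by positivity
    have cpi := continuous_ppi x0 hs0
    have ct := continuous_tt x0 (K * h) (d / 2)
    have iw : IntegrableOn (fun x => (K * h) ^ 2 * (pp x0 (K * h) x)⁻¹ ^ 5 *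
        tt x0 (K * h) (d / 2) x ^ 3 * u x ^ 2) Ω := (Gd.of_cont hb (by fun_prop)).io hΩ hb
    have hle1 : ∫ y in interior (tet v), u y ^ 2 ≤ 256 * (K * h) ^ 3 *
        ∫ x in Ω, (K * h) ^ 2 * (pp x0 (K * h) x)⁻¹ ^ 5 * tt x0 (K * h) (d / 2) x ^ 3 * u x ^ 2 := by
      calc ∫ y in interior (tet v), u y ^ 2 ≤ ∫ x in interior (tet v), 256 * (K * h) ^ 3 *
          ((K * h) ^ 2 * (pp x0 (K * h) x)⁻¹ ^ 5 * tt x0 (K * h) (d / 2) x ^ 3 * u x ^ 2) := by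
            refine setIntegral_mono_on (iu.mono_set hiΩ) ((iw.mono_set hiΩ).const_mul _) m fun x hx => ?_
            have hw := weight_lb (x0 := x0) (x := x) (R := d / 2) hs0 (by linarith)
              ((hdist x hx).trans (by linarith))
            have := mul_le_mul_of_nonneg_right hw (sq_nonneg (u x))
            linarith
        _ = 256 * (K * h) ^ 3 * ∫ x in interior (tet v),
          (K * h) ^ 2 * (pp x0 (K * h) x)⁻¹ ^ 5 * tt x0 (K * h) (d / 2) x ^ 3 * u x ^ 2 := by
            rw [integral_const_mul]
        _ ≤ _ := by
            gcongr
            apply Filter.Eventually.of_forall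
            intro x
            have := pp_pos (x0 := x0) hs0 x
            have := tt_nonneg x0 (K * h) (d / 2) x
            simp only [Pi.zero_apply]
            positivity
    have hle2 : ∫ x in Ω ∩ ball x0 d, u x ^ 2 ≤ Y := by
      apply setIntegral_mono_set (iu.mono_set inter_subset_left)
        (Filter.Eventually.of_forall fun x => sq_nonneg _)
      apply LE.le.eventuallyLE
      exact inter_subset_inter_right _ (ball_subset_ball (by linarith))
    have hd3 : (d / 2)⁻¹ ^ 3 ≤ 64 * ((d + 2 * h) ^ 3)⁻¹ := by
      have : (d / 2)⁻¹ ≤ 4 * (d + 2 * h)⁻¹ := by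
        rw [← div_eq_mul_inv, inv_eq_one_div, div_le_div_iff₀ (by positivity) hρ]
        linarith
      calc (d / 2)⁻¹ ^ 3 ≤ (4 * (d + 2 * h)⁻¹) ^ 3 := by gcongr
        _ = _ := by rw [mul_pow, inv_pow]; norm_num
    calc u x0 ^ 2 ≤ C2 * (h ^ 3)⁻¹ * ∫ y in interior (tet v), u y ^ 2 := I1
      _ ≤ C2 * (h ^ 3)⁻¹ * (256 * (K * h) ^ 3 * (C3 * (64 * ((d + 2 * h) ^ 3)⁻¹) * Y)) := by
        gcongr
        refine hle1.trans ?_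
        gcongr
        refine E.trans ?_
        gcongr
      _ = C2 * 256 * K ^ 3 * C3 * 64 * ((d + 2 * h) ^ 3)⁻¹ * Y := by field_simp
      _ ≤ _ := by
        gcongr
        have : 0 ≤ C2 * (4 * K + 2) ^ 3 := by positivity
        linarith

end PB

/-- **Pointwise bound for discrete harmonic functions by local `L²` norms (inequality (3.2)).** -/
theorem pointwise_bound_discrete_harmonic
    (Ω : Set E3) (hΩ : IsConvexPolyhedron Ω)
    (c : ℝ) (hc : 0 < c) (r : ℕ) (hr : 1 ≤ r) :
    ∃ C k h₀ : ℝ, 0 < C ∧ 1 ≤ k ∧ 0 < h₀ ∧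
      ∀ h : ℝ, 0 < h → h ≤ h₀ → ∀ T : Finset (Fin 4 → E3), IsTetPartition Ω T h c →
      ∀ u_h : E3 → ℝ, MemSh Ω T r u_h →
        (∀ χ : E3 → ℝ, MemSh0 Ω T r χ → ∫ x in Ω, ⟪gradient u_h x, gradient χ x⟫ = 0) →
      ∀ x₀ ∈ closure Ω,
        |u_h x₀| ≤ C * (Metric.infDist x₀ (frontier Ω) + 2 * k * h) ^ (-(3 : ℝ) / 2) *
          (∫ x in Ω ∩ Metric.ball x₀ (Metric.infDist x₀ (frontier Ω) + 2 * k * h),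
            |u_h x| ^ 2) ^ ((1 : ℝ) / 2) := by
  obtain ⟨C, hC, H⟩ := PB.main_sq r hr hc
  refine ⟨Real.sqrt C, 1, 1, Real.sqrt_pos.2 hC, le_rfl, one_pos, ?_⟩
  intro h hh _ T hT u hu hharm x₀ hx₀
  have key := H Ω hΩ.1 hΩ.2.1 hΩ.2.2.1 h hh T hT u hu hharm x₀ hx₀
  simp only [sq_abs, mul_one]
  have d0 : 0 ≤ Metric.infDist x₀ (frontier Ω) := Metric.infDist_nonneg
  have hρ : 0 < Metric.infDist x₀ (frontier Ω) + 2 * h := by positivity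
  generalize Metric.infDist x₀ (frontier Ω) + 2 * h = ρ at *
  have hY : 0 ≤ ∫ x in Ω ∩ Metric.ball x₀ ρ, u x ^ 2 := integral_nonneg fun x => sq_nonneg _
  generalize (∫ x in Ω ∩ Metric.ball x₀ ρ, u x ^ 2) = Y at *
  apply abs_le_of_sq_le_sq _ (by positivity)
  refine key.trans (le_of_eq ?_)
  rw [mul_pow, mul_pow, Real.sq_sqrt hC.le, ← Real.rpow_natCast (ρ ^ (-(3 : ℝ) / 2)) 2,
    ← Real.rpow_mul hρ.le, ← Real.sqrt_eq_rpow, Real.sq_sqrt hY]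
  congr 2
  rw [← Real.rpow_natCast, ← Real.rpow_neg hρ.le]
  norm_num
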